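/- arXiv:1602.06622 — 11 statements merged into one kernel-verified Lean document; each statement's English description precedes it below -/
import Mathlib

section
/- Every induced subgraph of a mock threshold graph is mock threshold. That is, if G is a finite simple graph that is mock threshold and X is any subset of its vertex set, then the subgraph of G induced on X is mock threshold. -/
/-- The degree of the `i`-th vertex of the ordering `v` within the prefix
`{v 0, …, v i}`, i.e. the number of earlier vertices adjacent to `v i`. -/
noncomputable def prefixDegree {n : ℕ} {V : Type*} (G : SimpleGraph V) (v : Fin n ≃ V) (i : Fin n) : ℕ :=
  Nat.card {j : Fin n // j < i ∧ G.Adj (v i) (v j)}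

/-- A finite simple graph is mock threshold if there is an ordering `v 0, …, v (n-1)` of its
vertices such that each `v i` has degree `0`, `1`, `(i+1)-2`, or `(i+1)-1` in the subgraph
induced on `{v 0, …, v i}` (a prefix of `i+1` vertices). -/
def IsMockThreshold {V : Type*} [Fintype V] (G : SimpleGraph V) : Prop :=
  ∃ v : Fin (Fintype.card V) ≃ V, ∀ i : Fin (Fintype.card V),
    prefixDegree G v i = 0 ∨ prefixDegree G v i = 1 ∨
    prefixDegree G v i = (i : ℕ) - 1 ∨ prefixDegree G v i = (i : ℕ)

/-- Among the `i` vertices preceding `v i`, those not adjacent to `v i` are the ones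
not counted by `prefixDegree`. -/
lemma prefixDegree_add_card_nonadj {n : ℕ} {V : Type*} (G : SimpleGraph V) (v : Fin n ≃ V)
    (i : Fin n) :
    prefixDegree G v i + Nat.card {j : Fin n // j < i ∧ ¬ G.Adj (v i) (v j)} = i := by
  classical
  simp only [prefixDegree, Nat.card_eq_fintype_card, Fintype.card_subtype, ← Finset.filter_filter]
  rw [Finset.card_filter_add_card_filter_not]
  rw [Finset.filter_gt_eq_Iio, Fin.card_Iio]

/-- The mock threshold condition at `i` says that `v i` has at most one earlier neighbour or at
most one earlier non-neighbour. -/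
lemma prefixDegree_mem_iff {n : ℕ} {V : Type*} (G : SimpleGraph V) (v : Fin n ≃ V) (i : Fin n) :
    (prefixDegree G v i = 0 ∨ prefixDegree G v i = 1 ∨
      prefixDegree G v i = (i : ℕ) - 1 ∨ prefixDegree G v i = (i : ℕ)) ↔
    prefixDegree G v i ≤ 1 ∨ Nat.card {j : Fin n // j < i ∧ ¬ G.Adj (v i) (v j)} ≤ 1 := by
  have := prefixDegree_add_card_nonadj G v i
  omega

theorem induced_subgraph_of_mockThreshold_isMockThreshold
    {V : Type*} [Fintype V] (G : SimpleGraph V) (hG : IsMockThreshold G)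
    (X : Finset V) : IsMockThreshold (G.induce (X : Set V)) := by
  obtain ⟨v, hv⟩ := hG
  let pos : ↥(X : Set V) → Fin (Fintype.card V) := fun x => v.symm x
  have pos_injective : Function.Injective pos := v.symm.injective.comp Subtype.val_injective
  let _ : LinearOrder ↥(X : Set V) := LinearOrder.lift' pos pos_injective
  let w := Fintype.orderIsoFinOfCardEq ↥(X : Set V) rfl
  have pos_lt {i j} (h : j < i) : pos (w j) < pos (w i) := w.strictMono h
  have v_pos (i) : v (pos (w i)) = w i := v.apply_symm_apply _
  refine ⟨w.toEquiv, fun i => (prefixDegree_mem_iff _ _ i).2 ?_⟩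
  refine ((prefixDegree_mem_iff G v (pos (w i))).1 (hv _)).imp (le_trans ?_) (le_trans ?_)
  all_goals
    refine Nat.card_le_card_of_injective
      (fun j => ⟨pos (w j), pos_lt j.2.1, by simpa [v_pos] using j.2.2⟩) fun j k h => ?_
    exact Subtype.ext (w.injective (pos_injective (Subtype.ext_iff.1 h)))
end

section
/- Every mock threshold graph is perfect: if G is a finite simple mock threshold graph, then for every induced subgraph H of G, the chromatic number of H equals the clique number of H. -/
namespace SimpleGraph

variable {V : Type*} {G : SimpleGraph V}

/-- The subgraph induced on `X` has a clique of size `k` and a proper coloring with `k` colors. -/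
def HasTightColoring (G : SimpleGraph V) (X : Finset V) (k : ℕ) : Prop :=
  (∃ c : V → ℕ, (∀ a ∈ X, c a < k) ∧ ∀ a ∈ X, ∀ b ∈ X, G.Adj a b → c a ≠ c b) ∧
    ∃ s ⊆ X, G.IsNClique k s

/-- The vertex `v` has at most one neighbor or at most one non-neighbor among the other
vertices of `X`. -/
def IsMockVertex (G : SimpleGraph V) (X : Finset V) (v : V) : Prop :=
  (∀ a ∈ X, ∀ b ∈ X, G.Adj v a → G.Adj v b → a = b) ∨
    ∀ a ∈ X, ∀ b ∈ X, a ≠ v → b ≠ v → ¬G.Adj v a → ¬G.Adj v b → a = b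

theorem exists_hasTightColoring_of_neighbor_unique [DecidableEq V] {X : Finset V} {v : V}
    (hv : v ∈ X) (h : ∀ a ∈ X, ∀ b ∈ X, G.Adj v a → G.Adj v b → a = b) {k : ℕ}
    (hk : G.HasTightColoring (X.erase v) k) : ∃ m, G.HasTightColoring X m := by
  obtain ⟨⟨c, hc, hadj⟩, s, hs, hcl⟩ := hk
  by_cases hu : ∃ u ∈ X, G.Adj v u
  · obtain ⟨u, huX, hvu⟩ := hu
    have huk : c u < k := hc u (by simp [huX, hvu.ne'])
    have hcol : ∀ d, d ≠ c u → ∀ a ∈ X, ∀ b ∈ X, G.Adj a b →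
        Function.update c v d a ≠ Function.update c v d b := by
      intro d hd a ha b hb hab
      by_cases hav : a = v
      · subst hav
        obtain rfl := h b hb u huX hab hvu
        simpa [Function.update_of_ne hab.ne'] using hd
      · by_cases hbv : b = v
        · subst hbv
          obtain rfl := h a ha u huX hab.symm hvu
          simpa [Function.update_of_ne hab.ne] using hd.symm
        · simpa [hav, hbv] using hadj a (by simp [ha, hav]) b (by simp [hb, hbv]) hab
    have hlt : ∀ d m, d < m → k ≤ m → ∀ a ∈ X, Function.update c v d a < m := by
      intro d m hd hm a ha
      by_cases hav : a = v
      · simpa [hav] using hd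
      · simpa [hav] using (hc a (by simp [ha, hav])).trans_le hm
    by_cases hk2 : 2 ≤ k
    · obtain ⟨d, hd, hdk⟩ : ∃ d, d ≠ c u ∧ d < k := by
        by_cases h0 : c u = 0
        · exact ⟨1, by omega, by omega⟩
        · exact ⟨0, by omega, by omega⟩
      exact ⟨k, ⟨_, hlt d k hdk le_rfl, hcol d hd⟩, s, hs.trans (X.erase_subset v), hcl⟩
    · refine ⟨2, ⟨_, hlt 1 2 (by omega) (by omega), hcol 1 (by omega)⟩, {v, u}, ?_, ?_⟩
      · simp [Finset.insert_subset_iff, hv, huX]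
      · simp [isNClique_iff, hvu, Finset.card_pair hvu.ne]
  · have hu : ∀ u ∈ X, ¬G.Adj v u := fun u h h' => hu ⟨u, h, h'⟩
    have hcol : ∀ a ∈ X, ∀ b ∈ X, G.Adj a b →
        Function.update c v 0 a ≠ Function.update c v 0 b := by
      intro a ha b hb hab
      have hav : a ≠ v := by rintro rfl; exact hu b hb hab
      have hbv : b ≠ v := by rintro rfl; exact hu a ha hab.symm
      simpa [hav, hbv] using hadj a (by simp [ha, hav]) b (by simp [hb, hbv]) hab
    have hlt : ∀ m, 0 < m → k ≤ m → ∀ a ∈ X, Function.update c v 0 a < m := by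
      intro m hd hm a ha
      by_cases hav : a = v
      · simpa [hav] using hd
      · simpa [hav] using (hc a (by simp [ha, hav])).trans_le hm
    rcases Nat.eq_zero_or_pos k with rfl | hpos
    · exact ⟨1, ⟨_, hlt 1 one_pos zero_le_one, hcol⟩, {v}, by simpa using hv,
        by simp [isNClique_iff]⟩
    · exact ⟨k, ⟨_, hlt k hpos le_rfl, hcol⟩, s, hs.trans (X.erase_subset v), hcl⟩

theorem exists_hasTightColoring_of_nonneighbor_unique [DecidableEq V] {X : Finset V} {v : V}
    (hv : v ∈ X)
    (h : ∀ a ∈ X, ∀ b ∈ X, a ≠ v → b ≠ v → ¬G.Adj v a → ¬G.Adj v b → a = b)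
    (ih : ∀ Y ⊂ X, ∃ k, G.HasTightColoring Y k) : ∃ m, G.HasTightColoring X m := by
  obtain ⟨k, ⟨c, hc, hadj⟩, s, hs, hcl⟩ := ih _ (Finset.erase_ssubset hv)
  have extend : ∀ t ⊆ X.erase v, (∀ a ∈ t, G.Adj v a) → G.IsNClique k t →
      ∃ m, G.HasTightColoring X m := by
    intro t ht hvt htk
    refine ⟨k + 1, ⟨Function.update c v k, ?_, ?_⟩, insert v t, ?_, htk.insert hvt⟩
    · intro a ha
      by_cases hav : a = v
      · simp [hav]
      · simpa [hav] using (hc a (by simp [ha, hav])).trans (Nat.lt_succ_self k)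
    · intro a ha b hb hab
      by_cases hav : a = v
      · subst hav
        simpa [hab.ne'] using (hc b (by simp [hb, hab.ne'])).ne'
      · by_cases hbv : b = v
        · subst hbv
          simpa [hab.ne] using (hc a (by simp [ha, hab.ne])).ne
        · simpa [hav, hbv] using hadj a (by simp [ha, hav]) b (by simp [hb, hbv]) hab
    · exact Finset.insert_subset hv (ht.trans (X.erase_subset v))
  by_cases hu : ∃ u ∈ X, u ≠ v ∧ ¬G.Adj v u
  · obtain ⟨u, huX, huv, hvu⟩ := hu
    have hss : (X.erase v).erase u ⊂ X :=
      (Finset.erase_subset _ _).trans_ssubset (Finset.erase_ssubset hv)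
    obtain ⟨l, ⟨d, hd, hdadj⟩, t, ht, htcl⟩ := ih _ hss
    rcases le_or_gt k l with hkl | hlk
    · obtain ⟨t', ht', hcard⟩ := Finset.exists_subset_card_eq (htcl.card_eq.symm ▸ hkl)
      have hsub := ht'.trans ht
      refine extend t' (hsub.trans (Finset.erase_subset _ _)) ?_
        ⟨htcl.isClique.subset (by exact_mod_cast ht'), hcard⟩
      intro a ha
      have ha' := hsub ha
      simp only [Finset.mem_erase] at ha'
      by_contra hva
      exact ha'.1 (h a ha'.2.2 u huX ha'.2.1 huv hva hvu)
    · have hmem : ∀ a ∈ X, ¬(a = u ∨ a = v) → a ∈ (X.erase v).erase u := by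
        intro a ha hn
        simp only [Finset.mem_erase]
        tauto
      refine ⟨k, ⟨fun a => if a = u ∨ a = v then l else d a, ?_, ?_⟩, s,
        hs.trans (X.erase_subset v), hcl⟩
      · intro a ha
        dsimp only
        split_ifs with hauv
        · exact hlk
        · exact (hd a (hmem a ha hauv)).trans hlk
      · intro a ha b hb hab
        dsimp only
        split_ifs with hauv hbuv hbuv
        · rcases hauv with rfl | rfl <;> rcases hbuv with rfl | rfl
          · exact absurd hab G.irrefl
          · exact absurd hab.symm hvu
          · exact absurd hab hvu
          · exact absurd hab G.irrefl
        · exact (hd b (hmem b hb hbuv)).ne'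
        · exact (hd a (hmem a ha hauv)).ne
        · exact hdadj a (hmem a ha hauv) b (hmem b hb hbuv) hab
  · refine extend s hs (fun a ha => ?_) hcl
    have ha' := hs ha
    simp only [Finset.mem_erase] at ha'
    by_contra hva
    exact hu ⟨a, ha'.2, ha'.1, hva⟩

theorem exists_hasTightColoring
    (hG : ∀ X : Finset V, X.Nonempty → ∃ v ∈ X, G.IsMockVertex X v) (X : Finset V) :
    ∃ k, G.HasTightColoring X k := by
  classical
  induction X using Finset.strongInduction with
  | H X ih =>
    rcases X.eq_empty_or_nonempty with rfl | hX
    · exact ⟨0, ⟨fun _ => 0, by simp, by simp⟩, ∅, by simp, by simp [isNClique_iff]⟩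
    · obtain ⟨v, hv, h | h⟩ := hG X hX
      · obtain ⟨k, hk⟩ := ih _ (Finset.erase_ssubset hv)
        exact exists_hasTightColoring_of_neighbor_unique hv h hk
      · exact exists_hasTightColoring_of_nonneighbor_unique hv h ih

theorem HasTightColoring.chromaticNumber_eq_cliqueNum {X : Finset V} {k : ℕ}
    (h : G.HasTightColoring X k) :
    (G.induce (X : Set V)).chromaticNumber = ((G.induce (X : Set V)).cliqueNum : ℕ∞) := by
  classical
  obtain ⟨⟨c, hc, hadj⟩, s, hs, hcl⟩ := h
  have hcol : (G.induce (X : Set V)).Colorable k :=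
    ⟨Coloring.mk (fun a => ⟨c a, hc a a.2⟩) fun {a b} hab heq =>
      hadj a a.2 b b.2 hab (Fin.mk.inj heq)⟩
  have hclique : (G.induce (X : Set V)).IsNClique k (s.subtype (· ∈ (X : Set V))) := by
    refine ⟨fun a ha b hb hab => ?_, ?_⟩
    · exact hcl.isClique (by simpa using ha) (by simpa using hb) (Subtype.coe_injective.ne hab)
    · rw [Finset.card_subtype, Finset.filter_true_of_mem fun a ha => Finset.mem_coe.2 (hs ha),
        hcl.card_eq]
  refine le_antisymm (hcol.chromaticNumber_le.trans ?_) cliqueNum_le_chromaticNumber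
  have := hclique.isClique.card_le_cliqueNum
  rw [hclique.card_eq] at this
  exact_mod_cast this

end SimpleGraph

theorem IsMockThreshold.exists_isMockVertex {V : Type*} [Fintype V] {G : SimpleGraph V}
    (hG : IsMockThreshold G) (X : Finset V) (hX : X.Nonempty) :
    ∃ v ∈ X, G.IsMockVertex X v := by
  classical
  obtain ⟨v, hdeg⟩ := hG
  obtain ⟨x, hx, hmax⟩ := X.exists_max_image v.symm hX
  have hlt : ∀ a ∈ X, a ≠ x → v.symm a < v.symm x := fun a ha hax =>
    lt_of_le_of_ne (hmax a ha) (v.symm.injective.ne hax)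
  refine ⟨x, hx, ?_⟩
  set i := v.symm x with hi
  have hvi : v i = x := by simp [hi]
  have hcard : prefixDegree G v i = ((Finset.Iio i).filter fun j => G.Adj x (v j)).card := by
    rw [prefixDegree, hvi, Nat.card_eq_fintype_card, Fintype.card_subtype]
    congr 1
    ext j
    simp
  have hsum := Finset.card_filter_add_card_filter_not (s := Finset.Iio i) (fun j => G.Adj x (v j))
  rw [← hcard, Fin.card_Iio] at hsum
  have hor : prefixDegree G v i ≤ 1 ∨
      ((Finset.Iio i).filter fun j => ¬G.Adj x (v j)).card ≤ 1 := by
    have := hdeg i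
    omega
  rcases hor with hle | hle
  · left
    rw [hcard, Finset.card_le_one] at hle
    intro a ha b hb hxa hxb
    refine v.symm.injective (hle _ ?_ _ ?_)
    · simpa [hxa] using hlt a ha hxa.ne'
    · simpa [hxb] using hlt b hb hxb.ne'
  · right
    rw [Finset.card_le_one] at hle
    intro a ha b hb hax hbx hxa hxb
    refine v.symm.injective (hle _ ?_ _ ?_)
    · simpa [hxa] using hlt a ha hax
    · simpa [hxb] using hlt b hb hbx

theorem mockThreshold_isPerfect {V : Type*} [Fintype V] (G : SimpleGraph V)
    (hG : IsMockThreshold G) (X : Finset V) :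
    (G.induce (X : Set V)).chromaticNumber = ((G.induce (X : Set V)).cliqueNum : ℕ∞) := by
  obtain ⟨k, hk⟩ := SimpleGraph.exists_hasTightColoring hG.exists_isMockVertex X
  exact hk.chromaticNumber_eq_cliqueNum
end

section
/- Let G be a finite simple graph on n vertices and let v be a removable vertex of G, i.e., a vertex whose degree in G is at most 1 or whose codegree in G is at most 1 (equivalently, whose degree is at least n−2). Then G is mock threshold if and only if the induced subgraph G − v obtained by deleting v is mock threshold. -/
/-- A vertex of an ordering has an admissible prefix degree iff it has at most one earlier
neighbour or at most one earlier non-neighbour. -/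
lemma prefixDegree_admissible_iff {n : ℕ} {V : Type*} (G : SimpleGraph V) (e : Fin n ≃ V)
    (i : Fin n) :
    (prefixDegree G e i = 0 ∨ prefixDegree G e i = 1 ∨
      prefixDegree G e i = (i : ℕ) - 1 ∨ prefixDegree G e i = (i : ℕ)) ↔
    {j | j < i ∧ G.Adj (e i) (e j)}.Subsingleton ∨
      {j | j < i ∧ ¬ G.Adj (e i) (e j)}.Subsingleton := by
  have hdeg : prefixDegree G e i = {j | j < i ∧ G.Adj (e i) (e j)}.ncard := rfl
  have hsum : {j | j < i ∧ G.Adj (e i) (e j)}.ncard +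
      {j | j < i ∧ ¬ G.Adj (e i) (e j)}.ncard = i := by
    rw [← Set.ncard_union_eq (Set.disjoint_left.2 fun j h h' => h'.2 h.2)]
    have : {j | j < i ∧ G.Adj (e i) (e j)} ∪ {j | j < i ∧ ¬ G.Adj (e i) (e j)} =
        ((Finset.Iio i : Finset (Fin n)) : Set (Fin n)) := by
      ext j
      simp only [Set.mem_union, Set.mem_ofPred_eq, Finset.coe_Iio, Set.mem_Iio]
      tauto
    rw [this, Set.ncard_coe_finset, Fin.card_Iio]
  rw [← Set.ncard_le_one_iff_subsingleton, ← Set.ncard_le_one_iff_subsingleton, hdeg]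
  omega

/-- A graph is mock threshold iff its vertices can be injectively labelled so that each vertex
has at most one neighbour or at most one non-neighbour of smaller label. -/
lemma isMockThreshold_iff_exists_injective {V : Type*} [Fintype V] (G : SimpleGraph V) :
    IsMockThreshold G ↔ ∃ f : V → ℕ, f.Injective ∧ ∀ w,
      {u | f u < f w ∧ G.Adj w u}.Subsingleton ∨
        {u | f u < f w ∧ ¬ G.Adj w u}.Subsingleton := by
  simp only [IsMockThreshold, prefixDegree_admissible_iff]
  constructor
  · rintro ⟨e, he⟩
    refine ⟨fun u => e.symm u, Fin.val_injective.comp e.symm.injective, fun w => ?_⟩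
    refine (he (e.symm w)).imp (fun h x hx y hy => ?_) (fun h x hx y hy => ?_) <;>
      exact e.symm.injective (h (by simpa using hx) (by simpa using hy))
  · rintro ⟨f, hf, h⟩
    let _ : LinearOrder V := LinearOrder.lift' f hf
    let e := monoEquivOfFin V rfl
    have hlt (i j) : f (e j) < f (e i) ↔ j < i := e.lt_iff_lt
    refine ⟨e.toEquiv, fun i => ?_⟩
    refine (h (e i)).imp (fun h x hx y hy => ?_) (fun h x hx y hy => ?_) <;>
      exact e.injective (h ⟨(hlt _ _).2 hx.1, hx.2⟩ ⟨(hlt _ _).2 hy.1, hy.2⟩)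

/-- Being mock threshold is inherited by induced subgraphs. -/
lemma IsMockThreshold.induce {V : Type*} [Fintype V] {G : SimpleGraph V}
    (hG : IsMockThreshold G) (s : Set V) [Fintype s] : IsMockThreshold (G.induce s) := by
  rw [isMockThreshold_iff_exists_injective] at hG ⊢
  obtain ⟨f, hf, h⟩ := hG
  refine ⟨fun u => f u, hf.comp Subtype.val_injective, fun w => ?_⟩
  exact (h w).imp (fun h x hx y hy => Subtype.ext (h hx hy))
    (fun h x hx y hy => Subtype.ext (h hx hy))

/-- An ordering of `G - v` extends to `G` by placing `v` last, if `v` has at most one neighbour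
or at most one non-neighbour. -/
lemma IsMockThreshold.of_induce {V : Type*} [Fintype V] {G : SimpleGraph V} {v : V} {s : Set V}
    [Fintype s] (hs : ∀ u, u ∈ s ↔ u ≠ v)
    (hv : {u | G.Adj v u}.Subsingleton ∨ {u | u ≠ v ∧ ¬ G.Adj v u}.Subsingleton)
    (hG : IsMockThreshold (G.induce s)) : IsMockThreshold G := by
  classical
  rw [isMockThreshold_iff_exists_injective] at hG ⊢
  obtain ⟨f, hf, h⟩ := hG
  obtain ⟨M, hM⟩ := (Set.finite_range f).bddAbove
  replace hM (u) : f u ≤ M := hM ⟨u, rfl⟩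
  let g : V → ℕ := fun u => if hu : u ∈ s then f ⟨u, hu⟩ else M + 1
  have hgs (u) (hu : u ∈ s) : g u = f ⟨u, hu⟩ := dif_pos hu
  have hgv : g v = M + 1 := dif_neg (by simp [hs])
  have hmem {u w} (hw : w ∈ s) (huw : g u < g w) : u ∈ s := by
    rw [hs]
    rintro rfl
    have := hM ⟨w, hw⟩
    rw [hgv, hgs w hw] at huw
    omega
  refine ⟨g, fun x y hxy => ?_, fun w => ?_⟩
  · by_cases hx : x ∈ s <;> by_cases hy : y ∈ s
    · rw [hgs x hx, hgs y hy] at hxy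
      exact congrArg Subtype.val (hf hxy)
    · have := hM ⟨x, hx⟩
      simp only [g, dif_pos hx, dif_neg hy] at hxy
      omega
    · have := hM ⟨y, hy⟩
      simp only [g, dif_pos hy, dif_neg hx] at hxy
      omega
    · rw [hs, not_not] at hx hy
      rw [hx, hy]
  · by_cases hw : w ∈ s
    · refine (h ⟨w, hw⟩).imp (fun h x hx y hy => ?_) (fun h x hx y hy => ?_) <;>
      · have hxs := hmem hw hx.1
        have hys := hmem hw hy.1
        refine congrArg Subtype.val (@h ⟨x, hxs⟩ ⟨?_, hx.2⟩ ⟨y, hys⟩ ⟨?_, hy.2⟩)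
        · simpa only [hgs _ hw, hgs _ hxs] using hx.1
        · simpa only [hgs _ hw, hgs _ hys] using hy.1
    · obtain rfl : w = v := by simpa [hs] using hw
      refine hv.imp (fun h => h.anti fun x hx => hx.2) (fun h => h.anti fun x hx => ⟨?_, hx.2⟩)
      rintro rfl
      exact lt_irrefl _ hx.1

theorem mockThreshold_iff_delete_removable {V : Type*} [Fintype V] [DecidableEq V]
    (G : SimpleGraph V) [DecidableRel G.Adj] (v : V)
    (hv : G.degree v ≤ 1 ∨ Fintype.card V - 1 - G.degree v ≤ 1) :
    IsMockThreshold G ↔ IsMockThreshold (G.induce ((Finset.univ.erase v : Finset V) : Set V)) := by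
  refine ⟨fun h => h.induce _, IsMockThreshold.of_induce (v := v) (by simp) ?_⟩
  rw [← SimpleGraph.degree_compl] at hv
  refine hv.imp (fun h x hx y hy => ?_) (fun h x hx y hy => ?_)
  · exact Finset.card_le_one.1 h x (by simpa using hx) y (by simpa using hy)
  · exact Finset.card_le_one.1 h x (by simpa [eq_comm] using hx) y (by simpa [eq_comm] using hy)
end

section
/- A finite simple graph that is the disjoint union of two cycles (each of length at least 3) is not mock threshold. -/
/-- The last vertex of an ordering has all of its neighbours before it. -/
theorem prefixDegree_eq_card_neighborSet {n : ℕ} {V : Type*} (G : SimpleGraph V)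
    (v : Fin n ≃ V) (i : Fin n) (hi : ∀ j, j ≤ i) :
    prefixDegree G v i = Nat.card (G.neighborSet (v i)) := by
  refine Nat.card_congr (v.subtypeEquiv fun j => ?_)
  refine ⟨fun h => h.2, fun h => ⟨lt_of_le_of_ne (hi j) ?_, h⟩⟩
  rintro rfl
  exact G.irrefl h

theorem card_neighborSet_cycleGraph {n : ℕ} (hn : 3 ≤ n) (v : Fin n) :
    Nat.card ((SimpleGraph.cycleGraph n).neighborSet v) = 2 := by
  obtain ⟨n, rfl⟩ := Nat.exists_eq_add_of_le' hn
  rw [Nat.card_eq_fintype_card, SimpleGraph.card_neighborSet_eq_degree,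
    SimpleGraph.cycleGraph_degree_three_le]

theorem card_neighborSet_sum_cycleGraph {k m : ℕ} (hk : 3 ≤ k) (hm : 3 ≤ m)
    (x : Fin k ⊕ Fin m) :
    Nat.card ((SimpleGraph.cycleGraph k ⊕g SimpleGraph.cycleGraph m).neighborSet x) = 2 := by
  rcases x with a | b
  · rw [SimpleGraph.neighborSet_sum_inl, Nat.card_image_of_injective Sum.inl_injective,
      card_neighborSet_cycleGraph hk]
  · rw [SimpleGraph.neighborSet_sum_inr, Nat.card_image_of_injective Sum.inr_injective,
      card_neighborSet_cycleGraph hm]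

theorem not_mockThreshold_of_two_disjoint_cycles {V : Type*} [Fintype V]
    (G : SimpleGraph V) (k m : ℕ) (hk : 3 ≤ k) (hm : 3 ≤ m)
    (h : Nonempty (G ≃g (SimpleGraph.cycleGraph k ⊕g SimpleGraph.cycleGraph m))) :
    ¬ IsMockThreshold G := by
  obtain ⟨e⟩ := h
  rintro ⟨v, hv⟩
  have hcard : Fintype.card V = k + m := by
    simpa using Fintype.card_congr e.toEquiv
  let i : Fin (Fintype.card V) := ⟨Fintype.card V - 1, by omega⟩
  have hdeg : prefixDegree G v i = 2 := by
    rw [prefixDegree_eq_card_neighborSet G v i fun j => Nat.le_sub_one_of_lt j.isLt,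
      Nat.card_congr (e.mapNeighborSet (v i)), card_neighborSet_sum_cycleGraph hk hm]
  have hi : (i : ℕ) = Fintype.card V - 1 := rfl
  have := hv i
  omega
end

section
/- A finite simple bipartite graph G is mock threshold if and only if either every connected component of G is a tree (i.e., G is a forest), or exactly one connected component of G is not a tree, that component consists of a complete bipartite graph K_{2,s} with s ≥ 2 together with, for each vertex of the K_{2,s}, optionally a tree attached to that vertex (identifying one vertex of the tree with that vertex, the attached trees being pairwise disjoint and disjoint from the K_{2,s} except at the attachment vertices), and every other component of G is a tree. -/
/-- `H` consists of a complete bipartite graph `K_{2,s}` (`s ≥ 2`) together with, at each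
of its vertices, optionally a tree attached (identifying one vertex of the tree with that
vertex, the trees being pairwise disjoint and otherwise disjoint from the `K_{2,s}`).
Formally: `H` is connected; there is a vertex set `A` inducing a `K_{2,s}` with `s ≥ 2`;
after deleting the edges inside `A` the graph is acyclic (the attached trees); and distinct
vertices of `A` are not joined outside `A` (each tree meets `A` in exactly one vertex). -/
def IsK2sWithTrees {W : Type*} (H : SimpleGraph W) : Prop :=
  H.Connected ∧ ∃ s : ℕ, 2 ≤ s ∧ ∃ A : Set W,
    Nonempty ((H.induce A) ≃g completeBipartiteGraph (Fin 2) (Fin s)) ∧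
    (H.deleteEdges {e : Sym2 W | ∀ x ∈ e, x ∈ A}).IsAcyclic ∧
    ∀ a ∈ A, ∀ b ∈ A, a ≠ b →
      ¬ (H.deleteEdges {e : Sym2 W | ∀ x ∈ e, x ∈ A}).Reachable a b

namespace SimpleGraph

variable {V : Type*} {G : SimpleGraph V} {A S : Set V}

/-- Every subset of `S` strictly containing `A` has a vertex outside `A`
with at most one neighbour in the set; that is, `S` can be built from `A` by successively
adding vertices that are isolated or pendant when added. -/
def IsPeelable (G : SimpleGraph V) (A S : Set V) : Prop :=
  ∀ T, A ⊂ T → T ⊆ S → ∃ v ∈ T \ A, (G.neighborSet v ∩ T).Subsingleton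

/-- The graph obtained from `G` by deleting all edges inside `A`. -/
abbrev deleteEdgesWithin (G : SimpleGraph V) (A : Set V) : SimpleGraph V :=
  G.deleteEdges {e : Sym2 V | ∀ x ∈ e, x ∈ A}

lemma deleteEdgesWithin_adj {x y : V} :
    (G.deleteEdgesWithin A).Adj x y ↔ G.Adj x y ∧ ¬ (x ∈ A ∧ y ∈ A) := by
  simp [deleteEdges_adj]

lemma deleteEdgesWithin_empty : G.deleteEdgesWithin ∅ = G := by
  ext x y
  rw [deleteEdgesWithin_adj]
  simp

/-- If the graph is peelable from `A`, every walk of positive length avoiding the edges inside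
`A` visits a vertex outside `A` with at most one neighbour along the walk. -/
lemma IsPeelable.exists_ncard_neighborSet_le_one [Finite V] (h : G.IsPeelable A Set.univ) {u v : V}
    (p : (G.deleteEdgesWithin A).Walk u v) (hp : ¬ p.Nil) :
    ∃ w ∈ p.support, w ∉ A ∧ (p.toSubgraph.neighborSet w).ncard ≤ 1 := by
  have hadj := deleteEdgesWithin_adj.1 (p.adj_snd hp)
  have hne : ∃ x ∈ p.support, x ∉ A := by
    by_contra! hA
    exact hadj.2 ⟨hA _ p.start_mem_support, hA _ (p.getVert_mem_support 1)⟩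
  obtain ⟨x, hx, hxA⟩ := hne
  obtain ⟨w, ⟨hw, hwA⟩, hsub⟩ := h (A ∪ {x | x ∈ p.support})
    ⟨Set.subset_union_left, fun hle => hxA (hle (Or.inr hx))⟩ (Set.subset_univ _)
  refine ⟨w, hw.resolve_left hwA, hwA, ?_⟩
  rw [Set.ncard_le_one_iff_subsingleton]
  refine hsub.anti fun y hy => ?_
  have hy' : p.toSubgraph.Adj w y := hy
  exact ⟨(deleteEdgesWithin_adj.1 hy'.adj_sub).1, Or.inr (by simpa using hy'.snd_mem)⟩

lemma IsPeelable.isAcyclic [Finite V] (h : G.IsPeelable A Set.univ) :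
    (G.deleteEdgesWithin A).IsAcyclic := by
  intro u p hp
  obtain ⟨w, hw, -, hcard⟩ := h.exists_ncard_neighborSet_le_one p hp.not_nil
  have := hp.ncard_neighborSet_toSubgraph_eq_two hw
  omega

lemma IsPeelable.not_reachable [Finite V] (h : G.IsPeelable A Set.univ) {a b : V} (ha : a ∈ A)
    (hb : b ∈ A) (hab : a ≠ b) : ¬ (G.deleteEdgesWithin A).Reachable a b := by
  intro hr
  obtain ⟨p, hp⟩ := hr.exists_isPath
  obtain ⟨w, hw, hwA, hcard⟩ := h.exists_ncard_neighborSet_le_one p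
    (fun hn => hab hn.eq)
  obtain ⟨i, rfl, hi⟩ := Walk.mem_support_iff_exists_getVert.1 hw
  have h0 : i ≠ 0 := by
    rintro rfl
    simp [ha] at hwA
  have h1 : i ≠ p.length := by
    rintro rfl
    simp [hb] at hwA
  have := hp.ncard_neighborSet_toSubgraph_internal_eq_two h0 (by omega)
  omega

lemma IsAcyclic.subsingleton_neighborSet_of_isPath {H : SimpleGraph V} (hH : H.IsAcyclic) {u v : V}
    {p : H.Walk u v} (hp : p.IsPath)
    (hmax : ∀ (u' v' : V) (p' : H.Walk u' v'), p'.IsPath → p'.length ≤ p.length) :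
    (H.neighborSet u).Subsingleton := by
  have key : ∀ w, H.Adj u w → w = p.snd := fun w hadj => by
    apply hH.eq_snd_of_adj_start hp hadj
    by_contra hw
    have := hmax _ _ _ (hp.cons hw (h := hadj.symm))
    simp at this
  intro x hx y hy
  rw [key x hx, key y hy]

lemma isPeelable_of_isAcyclic [Finite V] (hac : (G.deleteEdgesWithin A).IsAcyclic)
    (hA : ∀ a ∈ A, ∀ b ∈ A, a ≠ b → ¬ (G.deleteEdgesWithin A).Reachable a b) :
    G.IsPeelable A Set.univ := by
  intro T hT _
  by_contra! hcon
  obtain ⟨hAT, x, hxT, hxA⟩ := Set.ssubset_iff_exists.1 hT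
  let H := (G.deleteEdgesWithin A).induce T
  have hH : H.IsAcyclic := hac.induce T
  have : Nonempty T := ⟨⟨x, hxT⟩⟩
  obtain ⟨u, v, p, hp, hmax⟩ := Walk.exists_isPath_forall_isPath_length_le_length H
  have endpoint : ∀ w : T, (H.neighborSet w).Subsingleton → (w : V) ∈ A := by
    intro w hw
    by_contra hwA
    refine Set.not_nontrivial_iff.2 (fun y hy z hz => ?_) (hcon w ⟨w.2, hwA⟩)
    have hy' : H.Adj w ⟨y, hy.2⟩ := deleteEdgesWithin_adj.2 ⟨hy.1, fun h => hwA h.1⟩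
    have hz' : H.Adj w ⟨z, hz.2⟩ := deleteEdgesWithin_adj.2 ⟨hz.1, fun h => hwA h.1⟩
    exact congrArg Subtype.val (hw hy' hz')
  have hu := endpoint u (hH.subsingleton_neighborSet_of_isPath hp hmax)
  have hv := endpoint v (hH.subsingleton_neighborSet_of_isPath hp.reverse (by simpa using hmax))
  have hpos : 1 ≤ p.length := by
    obtain ⟨y, hy⟩ : (H.neighborSet ⟨x, hxT⟩).Nonempty := by
      by_contra! hemp
      exact hxA (endpoint ⟨x, hxT⟩ (by simp [hemp]))
    exact hmax _ _ (Path.singleton hy).1 (Path.singleton hy).2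
  refine hA u hu v hv (fun huv => ?_) (p.reachable.map (Embedding.induce T).toHom)
  obtain rfl := Subtype.ext huv
  exact absurd (Walk.isPath_iff_nil.1 hp) (Walk.not_nil_iff_lt_length.2 hpos)

/-- Peelability is inherited by induced subgraphs: the set `A` is replaced by its preimage. -/
lemma IsPeelable.induce (h : G.IsPeelable A Set.univ) (s : Set V) :
    (G.induce s).IsPeelable (Subtype.val ⁻¹' A) Set.univ := by
  intro T hT _
  obtain ⟨hAT, x, hxT, hxA⟩ := Set.ssubset_iff_exists.1 hT
  obtain ⟨v, ⟨hv, hvA⟩, hsub⟩ := h (A ∪ Subtype.val '' T)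
    ⟨Set.subset_union_left, fun hle => hxA (hle (Or.inr ⟨x, hxT, rfl⟩))⟩ (Set.subset_univ _)
  obtain ⟨w, hwT, rfl⟩ := hv.resolve_left hvA
  refine ⟨w, ⟨hwT, hvA⟩, fun y hy z hz => Subtype.ext (hsub ?_ ?_)⟩
  · exact ⟨hy.1, Or.inr ⟨y, hy.2, rfl⟩⟩
  · exact ⟨hz.1, Or.inr ⟨z, hz.2, rfl⟩⟩

/-- `A` induces a complete bipartite graph `K_{2,s}` with `s ≥ 2`. -/
def IsInducedK2 (G : SimpleGraph V) (A : Set V) : Prop :=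
  ∃ a b, ∃ B : Set V, a ≠ b ∧ B.Nontrivial ∧ A = insert a (insert b B) ∧ ¬ G.Adj a b ∧
    (∀ x ∈ B, G.Adj a x ∧ G.Adj b x) ∧ ∀ x ∈ B, ∀ y ∈ B, ¬ G.Adj x y

lemma IsInducedK2.exists_iso [Finite V] (h : G.IsInducedK2 A) :
    ∃ s : ℕ, 2 ≤ s ∧
      Nonempty ((G.induce A) ≃g completeBipartiteGraph (Fin 2) (Fin s)) := by
  obtain ⟨a, b, B, hab, hB, rfl, hnab, hadj, hind⟩ := h
  refine ⟨B.ncard, Set.one_lt_ncard_iff_nontrivial.2 hB, ?_⟩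
  let e : Fin B.ncard ≃ B := (Finite.equivFin B).symm
  let f : Fin 2 ⊕ Fin B.ncard → (insert a (insert b B) : Set V) :=
    Sum.elim ![⟨a, by simp⟩, ⟨b, by simp⟩] fun i => ⟨e i, by simp⟩
  have haB : a ∉ B := fun ha => G.irrefl (hadj a ha).1
  have hbB : b ∉ B := fun hb => G.irrefl (hadj b hb).2
  have hf : Function.Bijective f := by
    constructor
    · rintro (i | i) (j | j) hij
      · fin_cases i <;> fin_cases j <;> simp_all [f]
      · have := (e j).2
        fin_cases i <;> simp [f] at hij <;> simp_all
      · have := (e i).2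
        fin_cases j <;> simp [f] at hij <;> simp_all
      · have hval : (f (Sum.inr i) : V) = f (Sum.inr j) := congrArg _ hij
        exact congrArg Sum.inr (e.injective (Subtype.ext hval))
    · rintro ⟨x, rfl | rfl | hx⟩
      · exact ⟨Sum.inl 0, rfl⟩
      · exact ⟨Sum.inl 1, rfl⟩
      · exact ⟨Sum.inr (e.symm ⟨x, hx⟩), by simp [f]⟩
  refine ⟨(RelIso.mk (Equiv.ofBijective f hf) ?_).symm⟩
  have hA : ∀ i, G.Adj a (e i) ∧ G.Adj b (e i) := fun i => hadj _ (e i).2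
  rintro (i | i) (j | j)
  · fin_cases i <;> fin_cases j <;> simp [f, hnab, G.adj_comm b a]
  · fin_cases i <;> simp [f, hA]
  · fin_cases j <;> simp [f, (hA i).1.symm, (hA i).2.symm]
  · simpa [f] using hind _ (e i).2 _ (e j).2

lemma isInducedK2_of_iso {s : ℕ} (hs : 2 ≤ s)
    (φ : (G.induce A) ≃g completeBipartiteGraph (Fin 2) (Fin s)) : G.IsInducedK2 A := by
  have hadj : ∀ x y, G.Adj (φ.symm x) (φ.symm y) ↔
      (completeBipartiteGraph (Fin 2) (Fin s)).Adj x y := fun x y => φ.symm.map_adj_iff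
  have hinj : ∀ x y, (φ.symm x : V) = φ.symm y → x = y := fun x y h =>
    φ.symm.injective (Subtype.ext h)
  refine ⟨φ.symm (Sum.inl 0), φ.symm (Sum.inl 1),
    Set.range fun i => (φ.symm (Sum.inr i) : V), fun h => by simpa using hinj _ _ h,
    ⟨_, ⟨⟨0, by omega⟩, rfl⟩, _, ⟨⟨1, by omega⟩, rfl⟩, fun h => by simpa using hinj _ _ h⟩, ?_,
    by simp [hadj], by rintro _ ⟨i, rfl⟩; simp [hadj], ?_⟩
  · ext x
    constructor
    · intro hx
      obtain ⟨y, hy⟩ := φ.symm.surjective ⟨x, hx⟩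
      obtain rfl : (φ.symm y : V) = x := congrArg Subtype.val hy
      rcases y with i | i
      · fin_cases i <;> simp
      · exact Or.inr (Or.inr ⟨i, rfl⟩)
    · rintro (rfl | rfl | ⟨i, rfl⟩) <;> exact Subtype.coe_prop _
  · rintro _ ⟨i, rfl⟩ _ ⟨j, rfl⟩
    simp [hadj]

lemma IsInducedK2.preimage {s : Set V} (h : G.IsInducedK2 A) (hs : A ⊆ s) :
    (G.induce s).IsInducedK2 (Subtype.val ⁻¹' A) := by
  obtain ⟨a, b, B, hab, ⟨x, hx, y, hy, hxy⟩, rfl, hnab, hadj, hind⟩ := h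
  refine ⟨⟨a, hs (by simp)⟩, ⟨b, hs (by simp)⟩, Subtype.val ⁻¹' B, by simpa using hab,
    ⟨⟨x, hs (by simp [hx])⟩, hx, ⟨y, hs (by simp [hy])⟩, hy, by simpa using hxy⟩, ?_, hnab,
    fun z hz => hadj z hz, fun z hz w hw => hind z hz w hw⟩
  ext z
  simp [Subtype.ext_iff]

lemma IsInducedK2.image {s : Set V} {A : Set s} (h : (G.induce s).IsInducedK2 A) :
    G.IsInducedK2 (Subtype.val '' A) := by
  obtain ⟨a, b, B, hab, hB, rfl, hnab, hadj, hind⟩ := h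
  refine ⟨a, b, Subtype.val '' B, by simpa [Subtype.ext_iff] using hab,
    hB.image Subtype.val_injective, by simp [Set.image_insert_eq], hnab, ?_, ?_⟩
  · rintro _ ⟨z, hz, rfl⟩
    exact hadj z hz
  · rintro _ ⟨z, hz, rfl⟩ _ ⟨w, hw, rfl⟩
    exact hind z hz w hw

/-- An induced `K_{2,s}` lies in a single connected component. -/
lemma IsInducedK2.exists_subset_supp (h : G.IsInducedK2 A) :
    ∃ c : G.ConnectedComponent, A ⊆ c.supp := by
  obtain ⟨a, b, B, hab, ⟨x, hx, -⟩, rfl, hnab, hadj, hind⟩ := h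
  refine ⟨G.connectedComponentMk a, ?_⟩
  rintro z (hz | hz | hz) <;> simp only [ConnectedComponent.mem_supp_iff, ConnectedComponent.eq]
  · exact hz ▸ Reachable.refl _
  · exact hz ▸  ((hadj x hx).1.reachable.trans (hadj x hx).2.symm.reachable).symm
  · exact (hadj z hz).1.symm.reachable

/-- `S` is obtained from the empty set or from an induced `K_{2,s}` by adding isolated or
pendant vertices. -/
def HasPeelableCore (G : SimpleGraph V) (S : Set V) : Prop :=
  ∃ A, (A = ∅ ∨ G.IsInducedK2 A) ∧ A ⊆ S ∧ G.IsPeelable A S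

lemma HasPeelableCore.insert_of_subsingleton {v : V} (h : G.HasPeelableCore S) (hv : v ∉ S)
    (hsub : (G.neighborSet v ∩ S).Subsingleton) : G.HasPeelableCore (insert v S) := by
  obtain ⟨A, hA, hAS, hpeel⟩ := h
  refine ⟨A, hA, hAS.trans (Set.subset_insert _ _), fun T hAT hTS => ?_⟩
  by_cases hvT : v ∈ T
  · refine ⟨v, ⟨hvT, fun hvA => hv (hAS hvA)⟩, hsub.anti fun y hy => ⟨hy.1, ?_⟩⟩
    exact (hTS hy.2).resolve_left fun hyv => G.irrefl (hyv ▸ hy.1 : G.Adj v v)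
  · exact hpeel T hAT ((Set.subset_insert_iff_of_notMem hvT).1 hTS)

lemma hasPeelableCore_insert_of_adj {v w : V} (htri : G.CliqueFree 3) (hw : w ∈ S)
    (hv : v ∉ S) (hadj : ∀ x ∈ S, x ≠ w → G.Adj v x) : G.HasPeelableCore (insert v S) := by
  classical
  have tri : ∀ x y z, G.Adj x y → G.Adj x z → ¬ G.Adj y z := fun x y z hxy hxz hyz =>
    htri {x, y, z} (is3Clique_triple_iff.2 ⟨hxy, hxz, hyz⟩)
  have hvw : v ≠ w := fun h => hv (h ▸ hw)
  have hnbr : ∀ x ∈ S, x ≠ w → ¬ G.Adj w x → G.neighborSet x ∩ insert v S ⊆ {v} := by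
    rintro x hx hxw hwx y ⟨hxy, rfl | hy⟩
    · rfl
    · have hyw : y ≠ w := by
        rintro rfl
        exact hwx (G.adj_symm hxy)
      exact absurd hxy (tri v x y (hadj x hx hxw) (hadj y hy hyw))
  by_cases hnt : (G.neighborSet w ∩ S).Nontrivial
  · obtain ⟨t, ht, -⟩ := id hnt
    have hnvw : ¬ G.Adj v w := fun h =>
      tri v w t h (hadj t ht.2 (fun h' => G.irrefl (h' ▸ ht.1 : G.Adj w w))) ht.1
    refine ⟨insert v (insert w (G.neighborSet w ∩ S)), Or.inr ⟨v, w, _, hvw, hnt, rfl, hnvw,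
      fun x hx => ⟨hadj x hx.2 (G.ne_of_adj hx.1).symm, hx.1⟩,
      fun x hx y hy => tri w x y hx.1 hy.1⟩, ?_, fun T hAT hTS => ?_⟩
    · rintro x (rfl | rfl | hx)
      · simp
      · simp [hw]
      · simp [hx.2]
    · obtain ⟨-, x, hxT, hxA⟩ := Set.ssubset_iff_exists.1 hAT
      simp only [Set.mem_insert_iff, Set.mem_inter_iff, mem_neighborSet, not_or, not_and] at hxA
      have hxS : x ∈ S := (hTS hxT).resolve_left hxA.1
      refine ⟨x, ⟨hxT, by simpa using hxA⟩, ?_⟩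
      exact Set.subsingleton_singleton.anti ((Set.inter_subset_inter_right _ hTS).trans
        (hnbr x hxS hxA.2.1 fun h => hxA.2.2 h hxS))
  · rw [Set.not_nontrivial_iff] at hnt
    refine ⟨∅, Or.inl rfl, Set.empty_subset _, fun T hAT hTS => ?_⟩
    have hTne : T.Nonempty := Set.empty_ssubset.1 hAT
    simp only [Set.sdiff_empty]
    by_cases hwT : w ∈ T
    · refine ⟨w, hwT, Set.Subsingleton.anti ?_ (Set.inter_subset_inter_right _ hTS)⟩
      by_cases hwv : G.Adj w v
      · refine Set.subsingleton_singleton (a := v) |>.anti ?_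
        rintro y ⟨hwy, rfl | hy⟩
        · rfl
        · exact absurd (hadj y hy (G.ne_of_adj hwy).symm) (tri w v y hwv hwy)
      · refine hnt.anti ?_
        rintro y ⟨hwy, rfl | hy⟩
        · exact absurd hwy hwv
        · exact ⟨hwy, hy⟩
    · by_cases hx : ∃ x ∈ T, x ≠ v
      · obtain ⟨x, hxT, hxv⟩ := hx
        have hxS := (hTS hxT).resolve_left hxv
        refine ⟨x, hxT, ?_⟩
        by_cases hwx : G.Adj w x
        · refine Set.subsingleton_singleton (a := v) |>.anti ?_
          rintro y ⟨hxy, hyT⟩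
          rcases hTS hyT with rfl | hy
          · rfl
          · have hyw : y ≠ w := fun h => hwT (h ▸ hyT)
            have hxw : x ≠ w := fun h => hwT (h ▸ hxT)
            exact absurd hxy (tri v x y (hadj x hxS hxw) (hadj y hy hyw))
        · exact Set.subsingleton_singleton.anti ((Set.inter_subset_inter_right _ hTS).trans
            (hnbr x hxS (fun h => hwT (h ▸ hxT)) hwx))
      · push Not at hx
        obtain ⟨x, hxT⟩ := hTne
        exact ⟨x, hxT, fun y hy z hz => (hx y hy.2).trans (hx z hz.2).symm⟩

lemma HasPeelableCore.insert [Finite V] {v : V} (htri : G.CliqueFree 3) (h : G.HasPeelableCore S)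
    (hv : v ∉ S) (hdeg : (G.neighborSet v ∩ S).ncard ≤ 1 ∨
      S.ncard - 1 ≤ (G.neighborSet v ∩ S).ncard) : G.HasPeelableCore (insert v S) := by
  rcases hdeg with hdeg | hdeg
  · exact h.insert_of_subsingleton hv (Set.ncard_le_one_iff_subsingleton.1 hdeg)
  · have hcard := Set.ncard_inter_add_ncard_sdiff_eq_ncard S (G.neighborSet v)
    rw [Set.inter_comm] at hcard
    have hle : (S \ G.neighborSet v).Subsingleton :=
      Set.ncard_le_one_iff_subsingleton.1 (by omega)
    rcases S.eq_empty_or_nonempty with rfl | ⟨y, hy⟩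
    · exact h.insert_of_subsingleton hv (by simp)
    · by_cases hw : ∃ w ∈ S, ¬ G.Adj v w
      · obtain ⟨w, hwS, hw⟩ := hw
        refine hasPeelableCore_insert_of_adj htri hwS hv fun x hx hxw => ?_
        by_contra hvx
        exact hxw (hle ⟨hx, hvx⟩ ⟨hwS, hw⟩)
      · push Not at hw
        exact hasPeelableCore_insert_of_adj htri hy hv fun x hx _ => hw x hx

/-- `S` can be listed as `f 0, …, f (k - 1)` in a mock threshold order. -/
def HasMockThresholdOrder (G : SimpleGraph V) (S : Set V) : Prop :=
  ∃ (k : ℕ) (f : ℕ → V), Set.BijOn f (Set.Iio k) S ∧ ∀ i < k,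
    (G.neighborSet (f i) ∩ f '' Set.Iio i).ncard ≤ 1 ∨
      (G.neighborSet (f i) ∩ f '' Set.Iio i).ncard = i - 1

lemma hasMockThresholdOrder_empty [Nonempty V] : G.HasMockThresholdOrder ∅ :=
  ⟨0, fun _ => Classical.arbitrary V, by simp, by simp⟩

lemma HasMockThresholdOrder.insert {v : V} (h : G.HasMockThresholdOrder S) (hv : v ∉ S)
    (hdeg : (G.neighborSet v ∩ S).ncard ≤ 1 ∨ (G.neighborSet v ∩ S).ncard = S.ncard - 1) :
    G.HasMockThresholdOrder (insert v S) := by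
  obtain ⟨k, f, hf, hord⟩ := h
  have hagree : ∀ i ≤ k, Function.update f k v '' Set.Iio i = f '' Set.Iio i := fun i hi =>
    Set.image_congr fun j hj => Function.update_of_ne (by have := Set.mem_Iio.1 hj; omega) _ _
  have hk : S.ncard = k := by
    rw [← hf.image_eq, hf.injOn.ncard_image, Set.ncard_eq_toFinset_card']
    simp
  refine ⟨k + 1, Function.update f k v, ?_, fun i hi => ?_⟩
  · have hIio : Set.Iio (k + 1) = Insert.insert k (Set.Iio k) := by
      ext
      simp
    have hfk : Set.BijOn (Function.update f k v) (Set.Iio k) S :=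
      hf.congr fun j hj => (Function.update_of_ne (Set.mem_Iio.1 hj).ne _ _).symm
    rw [hIio]
    simpa using hfk.insert (a := k) (by simpa using hv)
  · rw [hagree i (by omega)]
    rcases Nat.lt_succ_iff_lt_or_eq.1 hi with hi | rfl
    · rw [Function.update_of_ne hi.ne]
      exact hord i hi
    · rw [Function.update_self, hf.image_eq]
      rwa [hk] at hdeg

lemma IsPeelable.hasMockThresholdOrder [Finite V] (h : G.IsPeelable A S) (hAS : A ⊆ S)
    (hA : G.HasMockThresholdOrder A) : G.HasMockThresholdOrder S := by
  suffices H : ∀ (n : ℕ) (T : Set V), T.ncard = n → A ⊆ T → T ⊆ S → G.HasMockThresholdOrder T from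
    H _ S rfl hAS subset_rfl
  intro n
  induction n with
  | zero =>
    intro T hT hAT _
    rw [Set.ncard_eq_zero] at hT
    rwa [hT, ← Set.subset_empty_iff.1 (hT ▸ hAT)]
  | succ n ih =>
    intro T hT hAT hTS
    rcases hAT.eq_or_ssubset with rfl | hAT'
    · exact hA
    · obtain ⟨v, ⟨hvT, hvA⟩, hsub⟩ := h T hAT' hTS
      have := ih (T \ {v}) (by rw [Set.ncard_sdiff_singleton_of_mem hvT, hT]; rfl)
        (Set.subset_sdiff_singleton hAT hvA) (Set.sdiff_subset.trans hTS)
      have := this.insert (v := v) (by simp) (Or.inl (Set.ncard_le_one_iff_subsingleton.2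
        (hsub.anti (Set.inter_subset_inter_right _ Set.sdiff_subset))))
      rwa [Set.insert_sdiff_singleton, Set.insert_eq_of_mem hvT] at this

lemma IsInducedK2.hasMockThresholdOrder [Finite V] (h : G.IsInducedK2 A) :
    G.HasMockThresholdOrder A := by
  obtain ⟨a, b, B, hab, hB, rfl, hnab, hadj, hind⟩ := h
  have haB : a ∉ B := fun ha => G.irrefl (hadj a ha).1
  have hbB : b ∉ B := fun hb => G.irrefl (hadj b hb).2
  have : Nonempty V := ⟨a⟩
  have h₁ : G.HasMockThresholdOrder {a} := by
    simpa using (hasMockThresholdOrder_empty (G := G)).insert (v := a) (by simp) (by simp)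
  have h₂ : G.HasMockThresholdOrder (Insert.insert a B) := by
    refine IsPeelable.hasMockThresholdOrder (A := {a}) (fun T hT hTS => ?_) (by simp) h₁
    obtain ⟨-, x, hxT, hxa⟩ := Set.ssubset_iff_exists.1 hT
    refine ⟨x, ⟨hxT, hxa⟩, Set.subsingleton_singleton (a := a) |>.anti ?_⟩
    rintro y ⟨hxy, hyT⟩
    rcases hTS hyT with rfl | hyB
    · rfl
    · exact absurd hxy (hind x ((hTS hxT).resolve_left hxa) y hyB)
  rw [Set.insert_comm]
  refine h₂.insert (by simp [hab.symm, hbB]) (Or.inr ?_)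
  have : G.neighborSet b ∩ Insert.insert a B = B := by
    ext y
    simp only [Set.mem_inter_iff, mem_neighborSet, Set.mem_insert_iff]
    constructor
    · rintro ⟨hby, rfl | hy⟩
      · exact absurd hby.symm hnab
      · exact hy
    · exact fun hy => ⟨(hadj y hy).2, Or.inr hy⟩
  rw [this, Set.ncard_insert_of_notMem haB, Nat.add_sub_cancel]

lemma HasPeelableCore.hasMockThresholdOrder [Finite V] [Nonempty V] (h : G.HasPeelableCore S) :
    G.HasMockThresholdOrder S := by
  obtain ⟨A, rfl | hA, hAS, hpeel⟩ := h
  · exact hpeel.hasMockThresholdOrder hAS hasMockThresholdOrder_empty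
  · exact hpeel.hasMockThresholdOrder hAS hA.hasMockThresholdOrder

lemma prefixDegree_eq_ncard {n : ℕ} (v : Fin n ≃ V) (i : Fin n) :
    prefixDegree G v i = (G.neighborSet (v i) ∩ v '' Set.Iio i).ncard := by
  rw [prefixDegree, ← Set.coe_ofPred, Nat.card_coe_set_eq,
    ← Set.ncard_image_of_injective _ v.injective]
  congr 1
  ext x
  simp only [Set.mem_image, Set.mem_ofPred_eq, Set.mem_inter_iff, mem_neighborSet, Set.mem_Iio]
  constructor
  · rintro ⟨j, ⟨hj, hadj⟩, rfl⟩
    exact ⟨hadj, j, hj, rfl⟩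
  · rintro ⟨hadj, j, hj, rfl⟩
    exact ⟨j, ⟨hj, hadj⟩, rfl⟩

lemma HasMockThresholdOrder.isMockThreshold [Fintype V]
    (h : G.HasMockThresholdOrder Set.univ) : IsMockThreshold G := by
  obtain ⟨k, f, hf, hord⟩ := h
  have hk : k = Fintype.card V := by
    have := hf.injOn.ncard_image
    rw [hf.image_eq, Set.ncard_univ, Nat.card_eq_fintype_card, Set.ncard_eq_toFinset_card'] at this
    simpa using this.symm
  subst hk
  have hbij : Function.Bijective fun i : Fin (Fintype.card V) => f i := by
    constructor
    · exact fun i j hij => Fin.ext (hf.injOn i.2 j.2 hij)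
    · intro x
      obtain ⟨i, hi, rfl⟩ := hf.surjOn (Set.mem_univ x)
      exact ⟨⟨i, hi⟩, rfl⟩
  refine ⟨Equiv.ofBijective _ hbij, fun i => ?_⟩
  have himage : (Equiv.ofBijective _ hbij) '' Set.Iio i = f '' Set.Iio (i : ℕ) := by
    ext x
    constructor
    · rintro ⟨j, hj, rfl⟩
      exact ⟨j, hj, rfl⟩
    · rintro ⟨j, hj, rfl⟩
      exact ⟨⟨j, lt_trans hj i.2⟩, hj, rfl⟩
  rw [prefixDegree_eq_ncard, himage]
  have := hord i i.2
  simp only [Equiv.ofBijective_apply]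
  omega

lemma hasPeelableCore_univ_of_isMockThreshold [Fintype V] (htri : G.CliqueFree 3)
    (h : IsMockThreshold G) : G.HasPeelableCore Set.univ := by
  obtain ⟨v, hv⟩ := h
  have key : ∀ k ≤ Fintype.card V, G.HasPeelableCore (v '' {j | (j : ℕ) < k}) := by
    intro k
    induction k with
    | zero =>
      exact fun _ => ⟨∅, Or.inl rfl, by simp, fun T hT hTS =>
        absurd (Set.empty_ssubset.1 hT) (by simp_all)⟩
    | succ k ih =>
      intro hk
      let i : Fin (Fintype.card V) := ⟨k, hk⟩
      have hset : {j : Fin (Fintype.card V) | (j : ℕ) < k + 1} = Insert.insert i (Set.Iio i) := by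
        ext j
        rw [Set.mem_insert_iff, Set.mem_Iio, ← le_iff_eq_or_lt]
        exact Nat.lt_succ_iff
      have hcard : (v '' Set.Iio i).ncard = k := by
        rw [Set.ncard_image_of_injective _ v.injective, Set.ncard_eq_toFinset_card']
        simp [i]
      have hi := hv i
      rw [prefixDegree_eq_ncard] at hi
      rw [hset, Set.image_insert_eq]
      refine HasPeelableCore.insert htri (ih (by omega)) (by simp) ?_
      rw [hcard]
      simp only [i] at hi ⊢
      omega
  have huniv : v '' {j | (j : ℕ) < Fintype.card V} = Set.univ := by
    simp
  exact huniv ▸ key _ le_rfl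

lemma isPeelable_empty_iff [Finite V] : G.IsPeelable ∅ Set.univ ↔ G.IsAcyclic := by
  refine ⟨fun h => deleteEdgesWithin_empty (G := G) ▸ h.isAcyclic, fun h => ?_⟩
  exact isPeelable_of_isAcyclic (by rwa [deleteEdgesWithin_empty]) (by simp)

lemma IsInducedK2.isK2sWithTrees [Finite V] (hA : G.IsInducedK2 A) (hconn : G.Connected)
    (h : G.IsPeelable A Set.univ) : IsK2sWithTrees G := by
  obtain ⟨s, hs, hiso⟩ := hA.exists_iso
  exact ⟨hconn, s, hs, A, hiso, h.isAcyclic, fun a ha b hb hab => h.not_reachable ha hb hab⟩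

lemma _root_.IsK2sWithTrees.exists_isInducedK2 [Finite V] (h : IsK2sWithTrees G) :
    ∃ A, G.IsInducedK2 A ∧ G.IsPeelable A Set.univ := by
  obtain ⟨-, s, hs, A, ⟨φ⟩, hac, hA⟩ := h
  exact ⟨A, isInducedK2_of_iso hs φ, isPeelable_of_isAcyclic hac hA⟩

lemma ConnectedComponent.exists_subsingleton_neighborSet (c : G.ConnectedComponent) {A : Set c.supp}
    (h : (G.induce c.supp).IsPeelable A Set.univ) {T : Set V} (hAT : A ⊂ Subtype.val ⁻¹' T) :
    ∃ v : c.supp, (v : V) ∈ T ∧ v ∉ A ∧ (G.neighborSet v ∩ T).Subsingleton := by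
  obtain ⟨v, ⟨hvT, hvA⟩, hsub⟩ := h _ hAT (Set.subset_univ _)
  refine ⟨v, hvT, hvA, fun y hy z hz => ?_⟩
  have hmem : ∀ y, G.Adj v y → y ∈ c.supp := fun y hy => c.mem_supp_of_adj_mem_supp v.2 hy
  exact congrArg Subtype.val
    (@hsub ⟨y, hmem y hy.1⟩ ⟨hy.1, hy.2⟩ ⟨z, hmem z hz.1⟩ ⟨hz.1, hz.2⟩)

lemma isPeelable_image_of_components [Finite V] (c : G.ConnectedComponent) {A : Set c.supp}
    (h : (G.induce c.supp).IsPeelable A Set.univ)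
    (hc : ∀ c' : G.ConnectedComponent, c' ≠ c → (G.induce c'.supp).IsAcyclic) :
    G.IsPeelable (Subtype.val '' A) Set.univ := by
  intro T hT _
  obtain ⟨hAT, x, hxT, hxA⟩ := Set.ssubset_iff_exists.1 hT
  by_cases hxc : x ∈ c.supp
  · obtain ⟨v, hvT, hvA, hsub⟩ := c.exists_subsingleton_neighborSet h (T := T)
      ⟨Set.image_subset_iff.1 hAT, fun hle => hxA ⟨⟨x, hxc⟩, hle hxT, rfl⟩⟩
    refine ⟨v, ⟨hvT, ?_⟩, hsub⟩
    rintro ⟨w, hw, hwv⟩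
    exact hvA (Subtype.ext hwv ▸ hw)
  · obtain ⟨v, hvT, -, hsub⟩ := (G.connectedComponentMk x).exists_subsingleton_neighborSet
      (isPeelable_empty_iff.2 (hc _ hxc)) (T := T) (Set.empty_ssubset.2 ⟨⟨x, rfl⟩, hxT⟩)
    refine ⟨v, ⟨hvT, ?_⟩, hsub⟩
    rintro ⟨w, hw, hwv⟩
    refine hxc ?_
    have h₁ : G.connectedComponentMk (w : V) = c := w.2
    have h₂ : G.connectedComponentMk (v : V) = G.connectedComponentMk x := v.2
    rw [ConnectedComponent.mem_supp_iff, ← h₂, ← hwv, h₁]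

end SimpleGraph

open SimpleGraph

theorem bipartite_mockThreshold_iff {V : Type*} [Fintype V] (G : SimpleGraph V)
    (hbip : G.Colorable 2) :
    IsMockThreshold G ↔
      (G.IsAcyclic ∨
        ∃ c : G.ConnectedComponent,
          IsK2sWithTrees (G.induce c.supp) ∧
          ∀ c' : G.ConnectedComponent, c' ≠ c → (G.induce c'.supp).IsTree) := by
  constructor
  · intro h
    obtain ⟨A, rfl | hA, -, hpeel⟩ :=
      hasPeelableCore_univ_of_isMockThreshold (hbip.cliqueFree (by norm_num)) h
    · exact Or.inl (isPeelable_empty_iff.1 hpeel)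
    · right
      obtain ⟨c, hc⟩ := hA.exists_subset_supp
      refine ⟨c, (hA.preimage hc).isK2sWithTrees c.connected_toSimpleGraph (hpeel.induce _),
        fun c' hc' => ⟨c'.connected_toSimpleGraph, isPeelable_empty_iff.1 ?_⟩⟩
      have hempty : (Subtype.val ⁻¹' A : Set c'.supp) = ∅ := by
        refine Set.eq_empty_of_forall_notMem fun x hx => hc' ?_
        exact (show G.connectedComponentMk x = c' from x.2).symm.trans (hc hx)
      exact hempty ▸ hpeel.induce c'.supp
  · intro h
    rcases isEmpty_or_nonempty V with hV | hV
    · exact ⟨Fintype.equivOfCardEq (by simp), fun i => (Fin.cast (by simp) i : Fin 0).elim0⟩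
    · refine HasMockThresholdOrder.isMockThreshold (HasPeelableCore.hasMockThresholdOrder ?_)
      rcases h with h | ⟨c, hK, hc⟩
      · exact ⟨∅, Or.inl rfl, Set.empty_subset _, isPeelable_empty_iff.2 h⟩
      · obtain ⟨A, hA, hpeel⟩ := hK.exists_isInducedK2
        exact ⟨_, Or.inr hA.image, Set.subset_univ _,
          isPeelable_image_of_components c hpeel fun c' hc' => (hc c' hc').isAcyclic⟩
end

section
/- For every n ≥ 5, the cycle C_n and its complement are both minimal non-mock-threshold graphs: C_n is not mock threshold but every proper induced subgraph of C_n is mock threshold, and likewise the complement of C_n is not mock threshold but every proper induced subgraph of the complement of C_n is mock threshold. -/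
theorem prefixDegree_add_prefixDegree_compl {n : ℕ} {V : Type*} (G : SimpleGraph V)
    (v : Fin n ≃ V) (i : Fin n) : prefixDegree G v i + prefixDegree Gᶜ v i = i := by
  classical
  have hcompl : ∀ j, (j < i ∧ Gᶜ.Adj (v i) (v j)) ↔ (j < i ∧ ¬ G.Adj (v i) (v j)) := by
    intro j
    refine and_congr_right fun hj => ?_
    simp [SimpleGraph.compl_adj, hj.ne']
  simp only [prefixDegree, hcompl, Nat.card_eq_fintype_card, Fintype.card_subtype]
  rw [← Finset.filter_filter, ← Finset.filter_filter, Finset.card_filter_add_card_filter_not]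
  rw [Finset.filter_gt_eq_Iio, Fin.card_Iio]

theorem IsMockThreshold.compl {V : Type*} [Fintype V] {G : SimpleGraph V}
    (h : IsMockThreshold G) : IsMockThreshold Gᶜ := by
  obtain ⟨v, hv⟩ := h
  refine ⟨v, fun i => ?_⟩
  have hsum := prefixDegree_add_prefixDegree_compl G v i
  have hdeg := hv i
  omega

/-- A graph is mock threshold if its vertices can be ranked so that each vertex has at most one
neighbor of smaller rank. -/
theorem isMockThreshold_of_injective {V : Type*} [Fintype V] {G : SimpleGraph V} (f : V → ℕ)
    (hf : Function.Injective f)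
    (hG : ∀ x y z, G.Adj x y → f y < f x → G.Adj x z → f z < f x → y = z) :
    IsMockThreshold G := by
  let : LinearOrder V := LinearOrder.lift' f hf
  let e : Fin (Fintype.card V) ≃o V := monoEquivOfFin V rfl
  refine ⟨e.toEquiv, fun i => ?_⟩
  have hlt : ∀ j, j < i → f (e j) < f (e i) := fun j hj => e.strictMono hj
  have hsub : Subsingleton {j // j < i ∧ G.Adj (e.toEquiv i) (e.toEquiv j)} :=
    ⟨fun j k => Subtype.ext <| e.injective <|
      hG _ _ _ j.2.2 (hlt _ j.2.1) k.2.2 (hlt _ k.2.1)⟩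
  have hle : prefixDegree G e.toEquiv i ≤ 1 := Finite.card_le_one_iff_subsingleton.2 hsub
  omega

theorem prefixDegree_last {n : ℕ} {V : Type*} [Fintype V] (G : SimpleGraph V)
    [DecidableRel G.Adj] (v : Fin (n + 1) ≃ V) :
    prefixDegree G v (Fin.last n) = G.degree (v (Fin.last n)) := by
  rw [← SimpleGraph.card_neighborSet_eq_degree, ← Nat.card_eq_fintype_card]
  refine Nat.card_congr (v.subtypeEquiv fun j => ?_)
  refine ⟨fun h => h.2, fun h => ⟨Fin.lt_last_iff_ne_last.2 ?_, h⟩⟩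
  rintro rfl
  exact G.loopless.irrefl _ h

theorem not_isMockThreshold_cycleGraph {n : ℕ} (hn : 5 ≤ n) :
    ¬ IsMockThreshold (SimpleGraph.cycleGraph n) := by
  obtain ⟨m, rfl⟩ := Nat.exists_eq_add_of_le' hn
  unfold IsMockThreshold
  rw [Fintype.card_fin]
  rintro ⟨v, hv⟩
  have hlast := hv (Fin.last (m + 4))
  rw [prefixDegree_last, SimpleGraph.cycleGraph_degree_three_le] at hlast
  simp only [Fin.val_last] at hlast
  omega

theorem eq_sub_one_of_cycleGraph_adj {n : ℕ} {a x y : Fin (n + 2)} (hy : y ≠ a)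
    (hadj : (SimpleGraph.cycleGraph (n + 2)).Adj x y) (hlt : (y - a).val < (x - a).val) :
    y = x - 1 := by
  rcases SimpleGraph.cycleGraph_adj.1 hadj with h | h
  · rw [← h]; abel
  · have hya : y - a = (x - a) + 1 := by rw [← h]; abel
    have hne : x - a ≠ Fin.last (n + 1) := by
      intro hx
      rw [hx, Fin.last_add_one] at hya
      exact hy (sub_eq_zero.1 hya)
    rw [hya, Fin.val_add_one_of_lt (Fin.lt_last_iff_ne_last.2 hne)] at hlt
    omega

theorem isMockThreshold_induce_cycleGraph {n : ℕ} (X : Finset (Fin (n + 2)))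
    (hX : X ≠ Finset.univ) :
    IsMockThreshold ((SimpleGraph.cycleGraph (n + 2)).induce (X : Set (Fin (n + 2)))) := by
  obtain ⟨a, ha⟩ : ∃ a, a ∉ X := by
    simpa [Finset.eq_univ_iff_forall] using hX
  have hne : ∀ y : (X : Set (Fin (n + 2))), y.1 ≠ a := fun y hy => ha (hy ▸ y.2)
  refine isMockThreshold_of_injective (fun x => (x.1 - a).val) (fun x y hxy => ?_) ?_
  · exact Subtype.ext (sub_left_injective (Fin.ext hxy))
  · intro x y z hxy hlty hxz hltz
    exact Subtype.ext <| (eq_sub_one_of_cycleGraph_adj (hne y) hxy hlty).trans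
      (eq_sub_one_of_cycleGraph_adj (hne z) hxz hltz).symm

theorem SimpleGraph.compl_induce {V : Type*} (G : SimpleGraph V) (s : Set V) :
    (G.induce s)ᶜ = Gᶜ.induce s := by
  ext x y
  simp [SimpleGraph.compl_adj, Subtype.ext_iff]

theorem cycle_and_compl_minimal_non_mockThreshold (n : ℕ) (hn : 5 ≤ n) :
    (¬ IsMockThreshold (SimpleGraph.cycleGraph n) ∧
      ∀ X : Finset (Fin n), X ≠ Finset.univ →
        IsMockThreshold ((SimpleGraph.cycleGraph n).induce (X : Set (Fin n)))) ∧
    (¬ IsMockThreshold (SimpleGraph.cycleGraph n)ᶜ ∧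
      ∀ X : Finset (Fin n), X ≠ Finset.univ →
        IsMockThreshold ((SimpleGraph.cycleGraph n)ᶜ.induce (X : Set (Fin n)))) := by
  have hnot := not_isMockThreshold_cycleGraph hn
  obtain ⟨m, rfl⟩ := Nat.exists_eq_add_of_le' (show 2 ≤ n by omega)
  refine ⟨⟨hnot, isMockThreshold_induce_cycleGraph⟩, fun h => hnot ?_, fun X hX => ?_⟩
  · simpa using h.compl
  · rw [← SimpleGraph.compl_induce]
    exact (isMockThreshold_induce_cycleGraph X hX).compl
end

section
/- Every mock threshold graph is weakly chordal: if G is mock threshold, then neither G nor the complement of G contains an induced cycle of length at least 5. -/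
/-- An ordering in which every vertex has at most one earlier neighbour or at most one earlier
non-neighbour. -/
def IsMockOrdering {n : ℕ} {V : Type*} (G : SimpleGraph V) (v : Fin n ≃ V) : Prop :=
  ∀ i, {j | j < i ∧ G.Adj (v i) (v j)}.Subsingleton ∨ {j | j < i ∧ ¬ G.Adj (v i) (v j)}.Subsingleton

theorem isMockOrdering_of_prefixDegree {n : ℕ} {V : Type*} {G : SimpleGraph V} {v : Fin n ≃ V}
    (h : ∀ i : Fin n, prefixDegree G v i = 0 ∨ prefixDegree G v i = 1 ∨
      prefixDegree G v i = (i : ℕ) - 1 ∨ prefixDegree G v i = (i : ℕ)) :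
    IsMockOrdering G v := by
  classical
  intro i
  have hdeg : prefixDegree G v i = {j ∈ Finset.Iio i | G.Adj (v i) (v j)}.card := by
    rw [prefixDegree, Nat.card_eq_fintype_card, Fintype.card_subtype]
    congr 1
    ext j
    simp
  have hsum := Finset.card_filter_add_card_filter_not (s := Finset.Iio i)
    (fun j => G.Adj (v i) (v j))
  rw [← hdeg, Fin.card_Iio] at hsum
  have hi := h i
  have key : prefixDegree G v i ≤ 1 ∨ {j ∈ Finset.Iio i | ¬ G.Adj (v i) (v j)}.card ≤ 1 := by
    omega
  rw [hdeg, Finset.card_le_one_iff_subsingleton, Finset.card_le_one_iff_subsingleton] at key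
  simpa using key

theorem IsMockOrdering.compl {n : ℕ} {V : Type*} {G : SimpleGraph V} {v : Fin n ≃ V}
    (h : IsMockOrdering G v) : IsMockOrdering Gᶜ v := by
  intro i
  refine (h i).symm.imp (fun hs => hs.anti ?_) (fun hs => hs.anti ?_)
  · rintro j ⟨hj, hadj⟩
    exact ⟨hj, hadj.2⟩
  · rintro j ⟨hj, hadj⟩
    refine ⟨hj, of_not_not fun hn => hadj ⟨fun e => hj.ne' (v.injective e), hn⟩⟩

theorem exists_two_neighbors_two_nonneighbors_cycleGraph {k : ℕ} (hk : 5 ≤ k) (a : Fin k) :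
    (∃ b c, b ≠ c ∧ (SimpleGraph.cycleGraph k).Adj a b ∧ (SimpleGraph.cycleGraph k).Adj a c) ∧
    ∃ d e, d ≠ e ∧ d ≠ a ∧ e ≠ a ∧
      ¬ (SimpleGraph.cycleGraph k).Adj a d ∧ ¬ (SimpleGraph.cycleGraph k).Adj a e := by
  obtain ⟨m, rfl⟩ := Nat.exists_eq_add_of_le' hk
  have cast_ne (r : ℕ) (h0 : 0 < r) (h5 : r < 5) : Fin.ofNat (m + 5) r ≠ 0 := by
    simp [Fin.ext_iff, Nat.mod_eq_of_lt (show r < m + 5 by omega), h0.ne']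
  have h1 : (1 : Fin (m + 5)) ≠ 0 := cast_ne 1 (by norm_num) (by norm_num)
  have h2 : (2 : Fin (m + 5)) ≠ 0 := cast_ne 2 (by norm_num) (by norm_num)
  have h3 : (3 : Fin (m + 5)) ≠ 0 := cast_ne 3 (by norm_num) (by norm_num)
  have h4 : (4 : Fin (m + 5)) ≠ 0 := cast_ne 4 (by norm_num) (by norm_num)
  simp only [SimpleGraph.cycleGraph_adj]
  open Fin.CommRing in
  refine ⟨⟨a + 1, a - 1, ?_, ?_, ?_⟩, ⟨a + 2, a - 2, ?_, ?_, ?_, ?_, ?_⟩⟩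
  · exact fun h => h2 (by linear_combination h)
  · exact .inr (by ring)
  · exact .inl (by ring)
  · exact fun h => h4 (by linear_combination h)
  · exact fun h => h2 (by linear_combination h)
  · exact fun h => h2 (by linear_combination -h)
  · rintro (h | h)
    · exact h3 (by linear_combination -h)
    · exact h1 (by linear_combination h)
  · rintro (h | h)
    · exact h1 (by linear_combination h)
    · exact h3 (by linear_combination -h)

theorem IsMockOrdering.not_nonempty_induce_iso_cycleGraph {n : ℕ} {V : Type*} {G : SimpleGraph V}
    {v : Fin n ≃ V} (h : IsMockOrdering G v) {k : ℕ} (hk : 5 ≤ k) (X : Set V) :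
    ¬ Nonempty (G.induce X ≃g SimpleGraph.cycleGraph k) := by
  rintro ⟨f⟩
  have : Nonempty (Fin k) := ⟨⟨0, by omega⟩⟩
  let pos : Fin k → Fin n := fun x => v.symm (f.symm x)
  have pos_inj : pos.Injective :=
    v.symm.injective.comp (Subtype.val_injective.comp f.symm.injective)
  have adj_iff (x y : Fin k) :
      G.Adj (v (pos x)) (v (pos y)) ↔ (SimpleGraph.cycleGraph k).Adj x y := by
    simp only [pos, Equiv.apply_symm_apply]
    exact f.symm.map_rel_iff (a := x) (b := y)
  obtain ⟨a, ha⟩ := Finite.exists_max pos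
  have lt_max {x : Fin k} (hx : x ≠ a) : pos x < pos a := (ha x).lt_of_ne (pos_inj.ne hx)
  obtain ⟨⟨b, c, hbc, hb, hc⟩, d, e, hde, hda, hea, hd, he⟩ :=
    exists_two_neighbors_two_nonneighbors_cycleGraph hk a
  rcases h (pos a) with hs | hs
  · exact hbc (pos_inj (hs ⟨lt_max hb.ne', (adj_iff _ _).2 hb⟩ ⟨lt_max hc.ne', (adj_iff _ _).2 hc⟩))
  · exact hde (pos_inj (hs ⟨lt_max hda, mt (adj_iff _ _).1 hd⟩ ⟨lt_max hea, mt (adj_iff _ _).1 he⟩))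

theorem mockThreshold_weakly_chordal {V : Type*} [Fintype V] (G : SimpleGraph V)
    (hG : IsMockThreshold G) (k : ℕ) (hk : 5 ≤ k) (X : Finset V) :
    ¬ Nonempty ((G.induce (X : Set V)) ≃g SimpleGraph.cycleGraph k) ∧
    ¬ Nonempty ((Gᶜ.induce (X : Set V)) ≃g SimpleGraph.cycleGraph k) := by
  obtain ⟨v, hv⟩ := hG
  have h := isMockOrdering_of_prefixDegree hv
  exact ⟨h.not_nonempty_induce_iso_cycleGraph hk X,
    h.compl.not_nonempty_induce_iso_cycleGraph hk X⟩
end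

section
/- Every finite simple graph on at most 5 vertices that is not isomorphic to the cycle C_5 is mock threshold. -/
/-- A closed tour through all vertices of a 2-regular graph on five vertices identifies it
with the five-cycle. -/
theorem nonempty_iso_cycleGraph_five {V : Type*} [Fintype V] (G : SimpleGraph V)
    [DecidableRel G.Adj] (hcard : Fintype.card V = 5) (hreg : G.IsRegularOfDegree 2)
    (f : Fin 5 → V) (hf : Function.Injective f) (hadj : ∀ i, G.Adj (f i) (f (i + 1))) :
    Nonempty (G ≃g SimpleGraph.cycleGraph 5) := by
  classical
  have hbij : Function.Bijective f :=
    (Fintype.bijective_iff_injective_and_card f).2 ⟨hf, by simp [hcard]⟩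
  have hnbr (i : Fin 5) : {f (i + 1), f (i - 1)} = G.neighborFinset (f i) := by
    apply Finset.eq_of_subset_of_card_le
    · intro x hx
      have hprev := hadj (i - 1)
      rw [sub_add_cancel] at hprev
      simp only [Finset.mem_insert, Finset.mem_singleton] at hx
      rcases hx with rfl | rfl
      · simpa using hadj i
      · simpa using hprev.symm
    · have hne : f (i + 1) ≠ f (i - 1) := hf.ne (by revert i; decide)
      rw [G.card_neighborFinset_eq_degree, hreg, Finset.card_pair hne]
  refine ⟨(RelIso.symm ⟨Equiv.ofBijective f hbij, ?_⟩)⟩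
  intro i j
  have hmem : G.Adj (f i) (f j) ↔ j = i + 1 ∨ j = i - 1 := by
    rw [← G.mem_neighborFinset, ← hnbr i]
    simp [hf.eq_iff]
  simp only [Equiv.ofBijective_apply, hmem, SimpleGraph.cycleGraph_adj]
  clear hmem
  revert i j
  decide

/-- The five-cycle is the only 2-regular graph on five vertices. -/
theorem nonempty_iso_cycleGraph_five_of_isRegularOfDegree {V : Type*} [Fintype V]
    (G : SimpleGraph V) [DecidableRel G.Adj] (hcard : Fintype.card V = 5)
    (hreg : G.IsRegularOfDegree 2) : Nonempty (G ≃g SimpleGraph.cycleGraph 5) := by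
  classical
  obtain ⟨a⟩ : Nonempty V := Fintype.card_pos_iff.1 (by omega)
  obtain ⟨b, c, hbc, hN⟩ := Finset.card_eq_two.1
    ((G.card_neighborFinset_eq_degree a).trans (hreg a))
  have hmemN (x : V) : G.Adj a x ↔ x = b ∨ x = c := by
    rw [← G.mem_neighborFinset, hN]; simp
  have hab : G.Adj a b := (hmemN b).2 (Or.inl rfl)
  have hac : G.Adj a c := (hmemN c).2 (Or.inr rfl)
  have hab' := hab.ne
  have hac' := hac.ne
  have hrest : ({a, b, c}ᶜ : Finset V).card = 2 := by
    rw [Finset.card_compl, hcard, Finset.card_eq_three.2 ⟨a, b, c, hab', hac', hbc, rfl⟩]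
  obtain ⟨d, e, hde, hD⟩ := Finset.card_eq_two.1 hrest
  have hmemD (x : V) : (x ≠ a ∧ x ≠ b ∧ x ≠ c) ↔ x = d ∨ x = e := by
    have := Finset.ext_iff.1 hD x
    simpa using this
  obtain ⟨hda, hdb, hdc⟩ := (hmemD d).2 (Or.inl rfl)
  obtain ⟨hea, heb, hec⟩ := (hmemD e).2 (Or.inr rfl)
  have huniv : (Finset.univ : Finset V) = {a, b, c, d, e} := by
    ext x
    have := hmemD x
    simp only [Finset.mem_univ, Finset.mem_insert, Finset.mem_singleton, true_iff]
    tauto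
  have hdeg (x : V) : (if G.Adj x a then 1 else 0) + ((if G.Adj x b then 1 else 0) +
      ((if G.Adj x c then 1 else 0) + ((if G.Adj x d then 1 else 0) +
      (if G.Adj x e then 1 else 0)))) = 2 := by
    have h := hreg x
    rw [← G.card_neighborFinset_eq_degree, G.neighborFinset_eq_filter, Finset.card_filter,
      huniv, Finset.sum_insert (by grind), Finset.sum_insert (by grind),
      Finset.sum_insert (by grind), Finset.sum_pair hde] at h
    exact h
  have hb := hdeg b
  have hc := hdeg c
  have hd := hdeg d
  have he := hdeg e
  have had : ¬ G.Adj a d := by rw [hmemN]; tauto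
  have hae : ¬ G.Adj a e := by rw [hmemN]; tauto
  simp only [G.loopless.irrefl, G.adj_comm b a, G.adj_comm c a, G.adj_comm d a, G.adj_comm e a,
    G.adj_comm c b, G.adj_comm d b, G.adj_comm e b, G.adj_comm d c, G.adj_comm e c,
    G.adj_comm e d, hab, hac, had, hae, if_true, if_false] at hb hc hd he
  have hpath : G.Adj d e ∧ ((G.Adj b d ∧ G.Adj c e) ∨ (G.Adj b e ∧ G.Adj c d)) := by
    split_ifs at hb hc hd he <;> first | omega | tauto
  obtain ⟨hde', ⟨hbd, hce⟩ | ⟨hbe, hcd⟩⟩ := hpath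
  · refine nonempty_iso_cycleGraph_five G hcard hreg ![a, b, d, e, c] ?_ ?_
    · intro i j; fin_cases i <;> fin_cases j <;> simp <;> grind
    · intro i; fin_cases i
      exacts [hab, hbd, hde', hce.symm, hac.symm]
  · refine nonempty_iso_cycleGraph_five G hcard hreg ![a, b, e, d, c] ?_ ?_
    · intro i j; fin_cases i <;> fin_cases j <;> simp <;> grind
    · intro i; fin_cases i
      exacts [hab, hbe, hde'.symm, hcd.symm, hac.symm]

theorem prefixDegree_le {n : ℕ} {V : Type*} (G : SimpleGraph V) (v : Fin n ≃ V) (i : Fin n) :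
    prefixDegree G v i ≤ i := by
  calc prefixDegree G v i ≤ Nat.card {j : Fin n // j < i} :=
        Nat.card_le_card_of_injective _
          (Subtype.map_injective (p := fun j => j < i ∧ G.Adj (v i) (v j))
            (fun _ h => h.1) Function.injective_id)
    _ = i := by
        rw [Nat.card_eq_fintype_card, Fintype.card_subtype, Finset.filter_gt_eq_Iio, Fin.card_Iio]

/-- If no other index exceeds `i`, then the prefix degree of `v i` is its degree. -/
theorem prefixDegree_eq_degree {n : ℕ} {V : Type*} [Fintype V] (G : SimpleGraph V)
    [DecidableRel G.Adj] (v : Fin n ≃ V) (i : Fin n) (hi : ∀ j, j ≤ i) :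
    prefixDegree G v i = G.degree (v i) := by
  rw [← G.card_neighborSet_eq_degree, ← Nat.card_eq_fintype_card]
  refine Nat.card_congr (v.subtypeEquiv fun j => ?_)
  rw [SimpleGraph.mem_neighborSet]
  exact ⟨fun h => h.2, fun h => ⟨(hi j).lt_of_ne fun hji => h.ne (hji ▸ rfl), h⟩⟩

theorem small_graph_isMockThreshold {V : Type*} [Fintype V] (G : SimpleGraph V)
    (hcard : Fintype.card V ≤ 5) (hC5 : ¬ Nonempty (G ≃g SimpleGraph.cycleGraph 5)) :
    IsMockThreshold G := by
  classical
  let w : Fin (Fintype.card V) ≃ V := (Fintype.equivFin V).symm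
  rcases hcard.lt_or_eq with hlt | heq
  · refine ⟨w, fun i => ?_⟩
    have := prefixDegree_le G w i
    omega
  · obtain ⟨x, hx⟩ : ∃ x, G.degree x ≠ 2 := by
      by_contra! h
      exact hC5 (nonempty_iso_cycleGraph_five_of_isRegularOfDegree G heq h)
    let last : Fin (Fintype.card V) := ⟨4, by omega⟩
    let v := (Equiv.swap last (w.symm x)).trans w
    have hlast : v last = x := by simp [v]
    refine ⟨v, fun i => ?_⟩
    have hle := prefixDegree_le G v i
    by_cases hi : i = last
    · have hdeg := prefixDegree_eq_degree G v last fun j => Fin.le_def.2 (by simp [last]; omega)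
      rw [hlast] at hdeg
      subst hi
      have : (last : ℕ) = 4 := rfl
      omega
    · have : (i : ℕ) ≠ 4 := fun h => hi (Fin.ext h)
      omega
end

section
/- Every minimal non-mock-threshold graph that is not isomorphic to a cycle of length at least 5 and not isomorphic to the complement of a cycle of length at least 5 has at most 10 vertices. -/
/-- A graph is a minimal non-mock-threshold graph if it is not mock threshold but every
proper induced subgraph of it is mock threshold. -/
def IsMinimalNonMockThreshold {V : Type*} [Fintype V] (G : SimpleGraph V) : Prop :=
  ¬ IsMockThreshold G ∧
    ∀ X : Finset V, X ≠ Finset.univ → IsMockThreshold (G.induce (X : Set V))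

namespace MockThreshold

open Finset Classical

variable {V : Type*} {G : SimpleGraph V}

/-- The number of neighbours of `v` inside `X`. -/
noncomputable def degIn (G : SimpleGraph V) (X : Finset V) (v : V) : ℕ :=
  #{u ∈ X | G.Adj v u}

theorem degIn_mono {X Y : Finset V} (h : X ⊆ Y) (v : V) : degIn G X v ≤ degIn G Y v :=
  card_le_card (filter_subset_filter _ h)

theorem degIn_congr {X Y : Finset V} {v : V} (hXY : X ⊆ Y)
    (h : ∀ u ∈ Y, G.Adj v u → u ∈ X) : degIn G X v = degIn G Y v := by
  unfold degIn
  congr 1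
  ext u
  simp only [mem_filter]
  exact ⟨fun hu => ⟨hXY hu.1, hu.2⟩, fun hu => ⟨h u hu.1 hu.2, hu.2⟩⟩

theorem two_le_degIn {X : Finset V} {v p q : V} (hp : p ∈ X) (hq : q ∈ X) (hpq : p ≠ q)
    (hvp : G.Adj v p) (hvq : G.Adj v q) : 2 ≤ degIn G X v := by
  rw [← card_pair hpq]
  apply card_le_card
  intro u hu
  simp only [mem_insert, mem_singleton] at hu
  rcases hu with rfl | rfl <;> simp [*]

theorem exists_forall_eq_of_degIn_le_one {X : Finset V} {v : V} (h : degIn G X v ≤ 1) :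
    ∃ e, ∀ u ∈ X, G.Adj v u → u = e := by
  have : Nonempty V := ⟨v⟩
  obtain ⟨e, he⟩ := card_le_one_iff_subset_singleton.1 h
  exact ⟨e, fun u hu hvu => by simpa using he (mem_filter.2 ⟨hu, hvu⟩)⟩

theorem exists_ne_of_one_lt_degIn {X : Finset V} {v : V} (h : 1 < degIn G X v) :
    ∃ p q, p ≠ q ∧ G.Adj v p ∧ G.Adj v q := by
  obtain ⟨p, hp, q, hq, hpq⟩ := one_lt_card.1 h
  exact ⟨p, q, hpq, (mem_filter.1 hp).2, (mem_filter.1 hq).2⟩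

theorem degIn_add_card_compl {X : Finset V} {v : V} (hv : v ∈ X) :
    degIn G X v + degIn Gᶜ X v + 1 = #X := by
  have h : degIn Gᶜ X v = #({u ∈ X | ¬ G.Adj v u}.erase v) := by
    unfold degIn
    congr 1
    ext u
    simp only [mem_filter, SimpleGraph.compl_adj, mem_erase]
    tauto
  have hmem : v ∈ {u ∈ X | ¬ G.Adj v u} := by simp [hv]
  have h1 := card_erase_add_one hmem
  have h2 := card_filter_add_card_filter_not (s := X) (fun u => G.Adj v u)
  rw [h, degIn]
  omega

theorem degIn_add_three_le {X : Finset V} {v p q : V} (hv : v ∈ X) (hp : p ∈ X) (hq : q ∈ X)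
    (hpq : p ≠ q) (hpv : p ≠ v) (hqv : q ≠ v) (hvp : ¬ G.Adj v p) (hvq : ¬ G.Adj v q) :
    degIn G X v + 3 ≤ #X := by
  have h := two_le_degIn (G := Gᶜ) (v := v) hp hq hpq (by simp [hvp, hpv.symm])
    (by simp [hvq, hqv.symm])
  have := degIn_add_card_compl (G := G) hv
  omega

theorem degIn_lt_card {X : Finset V} {v : V} (hv : v ∈ X) : degIn G X v < #X := by
  have := degIn_add_card_compl (G := G) hv
  omega

theorem degIn_erase_add {X : Finset V} {u v : V} (hv : v ∈ X) :
    degIn G (X.erase v) u + (if G.Adj u v then 1 else 0) = degIn G X u := by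
  unfold degIn
  rw [filter_erase]
  split_ifs with h
  · exact card_erase_add_one (by simp [hv, h])
  · rw [erase_eq_of_notMem (by simp [h]), add_zero]

theorem sum_degIn_erase {K : Finset V} {x : V} (hx : x ∈ K) :
    ∑ v ∈ K, degIn G K v = ∑ v ∈ K.erase x, degIn G (K.erase x) v + 2 * degIn G K x := by
  have hx0 : ∑ v ∈ K.erase x, (if G.Adj v x then 1 else 0) = degIn G K x := by
    rw [sum_boole, degIn, filter_erase, erase_eq_of_notMem (by simp)]
    simp [G.adj_comm]
  rw [← add_sum_erase K _ hx, ← sum_congr rfl fun v _ => degIn_erase_add (u := v) hx,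
    sum_add_distrib, hx0]
  omega

/-- A nonempty set spanning at least as many edges as vertices has a nonempty subset in which all
degrees are at least two. -/
theorem exists_two_core (K : Finset V) (hK : K.Nonempty)
    (h : 2 * #K ≤ ∑ v ∈ K, degIn G K v + 1) :
    ∃ Y ⊆ K, Y.Nonempty ∧ ∀ v ∈ Y, 2 ≤ degIn G Y v := by
  induction K using Finset.strongInduction with
  | H K ih =>
    by_cases hlow : ∀ v ∈ K, 2 ≤ degIn G K v
    · exact ⟨K, Subset.rfl, hK, hlow⟩
    push Not at hlow
    obtain ⟨x, hx, hxd⟩ := hlow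
    have hc := card_erase_add_one hx
    have hs := sum_degIn_erase (G := G) hx
    have hne : (K.erase x).Nonempty := by
      rw [nonempty_iff_ne_empty]
      intro h0
      rw [h0] at hc hs
      have : degIn G K x = 0 := by
        have h1 : #K = 1 := by simpa using hc.symm
        obtain ⟨y, rfl⟩ := card_eq_one.1 h1
        obtain rfl : x = y := by simpa using hx
        simp [degIn, filter_singleton]
      rw [this, sum_empty] at hs
      rw [card_empty] at hc
      omega
    obtain ⟨Y, hY, h1, h2⟩ := ih _ (erase_ssubset hx) hne (by omega)
    exact ⟨Y, hY.trans (erase_subset _ _), h1, h2⟩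

/-- The vertices of `X` with a neighbour in `S`. -/
noncomputable def nbrsIn (G : SimpleGraph V) (X S : Finset V) : Finset V :=
  {u ∈ X | ∃ s ∈ S, G.Adj s u}

theorem card_nbrsIn_le_sum (X S : Finset V) : #(nbrsIn G X S) ≤ ∑ s ∈ S, degIn G X s := by
  have h : nbrsIn G X S ⊆ S.biUnion fun s => {u ∈ X | G.Adj s u} := by
    intro u hu
    obtain ⟨hu, s, hs, hsu⟩ := mem_filter.1 hu
    exact mem_biUnion.2 ⟨s, hs, mem_filter.2 ⟨hu, hsu⟩⟩
  exact (card_le_card h).trans card_biUnion_le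

theorem card_nbrsIn_le (X S : Finset V) : #(nbrsIn G X S) ≤ #X :=
  card_le_card (filter_subset _ _)

theorem sum_degIn_add_sum_degIn_of_disjoint {S T : Finset V} (h : Disjoint S T) :
    ∑ s ∈ S, degIn G T s + ∑ t ∈ T, degIn Gᶜ S t = #S * #T := by
  have h1 : ∑ t ∈ T, degIn Gᶜ S t = ∑ t ∈ T, ∑ s ∈ S, if G.Adj s t then 0 else 1 := by
    refine sum_congr rfl fun t ht => ?_
    rw [degIn, card_filter]
    refine sum_congr rfl fun s hs => ?_
    have hne : t ≠ s := fun e => disjoint_left.1 h hs (e ▸ ht)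
    simp only [SimpleGraph.compl_adj, G.adj_comm s t]
    split_ifs <;> tauto
  have h2 : ∑ s ∈ S, degIn G T s = ∑ s ∈ S, ∑ t ∈ T, if G.Adj s t then 1 else 0 :=
    sum_congr rfl fun s _ => by rw [degIn, card_filter]
  rw [h1, h2, sum_comm (s := T), ← sum_add_distrib, ← smul_eq_mul, ← sum_const]
  refine sum_congr rfl fun s _ => ?_
  rw [← sum_add_distrib, card_eq_sum_ones]
  exact sum_congr rfl fun t _ => by split_ifs <;> rfl

theorem degIn_induce (X : Finset V) [Fintype (X : Set V)] (v : (X : Set V)) :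
    degIn (G.induce (X : Set V)) univ v = degIn G X v := by
  unfold degIn
  rw [← card_map (Function.Embedding.subtype _)]
  congr 1
  ext u
  simp [and_comm]

/-- The graph `G` with all edges at `a` deleted. -/
def avoid (G : SimpleGraph V) (a : V) : SimpleGraph V where
  Adj u v := G.Adj u v ∧ u ≠ a ∧ v ≠ a
  symm := ⟨fun _ _ h => ⟨h.1.symm, h.2.2, h.2.1⟩⟩
  loopless := ⟨fun _ h => h.1.ne rfl⟩

theorem cycleGraph_adj_iff_val {n : ℕ} {u v : Fin n} (hn : 3 ≤ n) :
    (SimpleGraph.cycleGraph n).Adj u v ↔ (u : ℕ) = v + 1 ∨ (v : ℕ) = u + 1 ∨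
      ((u : ℕ) = 0 ∧ (v : ℕ) + 1 = n) ∨ ((v : ℕ) = 0 ∧ (u : ℕ) + 1 = n) := by
  rw [SimpleGraph.cycleGraph_adj']
  have hu := u.isLt
  have hv := v.isLt
  rcases lt_trichotomy u v with h | rfl | h
  · rw [Fin.coe_sub_iff_lt.2 h, Fin.coe_sub_iff_le.2 h.le]
    have : (u : ℕ) < v := h
    omega
  · have : NeZero n := ⟨by omega⟩
    simp only [sub_self, Fin.val_zero]
    omega
  · rw [Fin.coe_sub_iff_lt.2 h, Fin.coe_sub_iff_le.2 h.le]
    have : (v : ℕ) < u := h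
    omega

/-- If the two neighbours of a vertex of degree two remain connected after deleting that vertex,
then they are adjacent, have another common neighbour, or there is a hole. -/
theorem adj_or_exists_adj_or_hole {a p q : V} (hpq : p ≠ q)
    (hN : ∀ r, G.Adj a r ↔ r = p ∨ r = q) (hr : (avoid G a).Reachable p q) :
    G.Adj p q ∨ (∃ u, u ≠ a ∧ G.Adj u p ∧ G.Adj u q) ∨
      ∃ m, 5 ≤ m ∧ Nonempty (SimpleGraph.cycleGraph m ↪g G) := by
  obtain ⟨w, hw⟩ := hr.exists_walk_length_eq_dist
  set L := w.length with hL
  have hpa : p ≠ a := fun h => (G.ne_of_adj ((hN p).2 (Or.inl rfl))) h.symm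
  have hqa : q ≠ a := fun h => (G.ne_of_adj ((hN q).2 (Or.inr rfl))) h.symm
  have hsucc : ∀ i < L, (avoid G a).Adj (w.getVert i) (w.getVert (i + 1)) :=
    fun i hi => w.adj_getVert_succ hi
  have h0 : w.getVert 0 = p := w.getVert_zero
  have hLq : w.getVert L = q := w.getVert_length
  have hne : ∀ i ≤ L, w.getVert i ≠ a := by
    intro i hi
    rcases hi.lt_or_eq with h | rfl
    · exact (hsucc i h).2.1
    · rwa [hLq]
  have hskip : ∀ i j, i < j → j ≤ L → G.Adj (w.getVert i) (w.getVert j) → j = i + 1 := by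
    intro i j hij hj h
    have h' : (avoid G a).Adj (w.getVert i) (w.getVert j) := ⟨h, hne i (by omega), hne j hj⟩
    have hd := SimpleGraph.dist_le (((w.take i).concat h').append (w.drop j))
    rw [SimpleGraph.Walk.length_append, SimpleGraph.Walk.length_concat,
      SimpleGraph.Walk.take_length, SimpleGraph.Walk.drop_length, ← hw] at hd
    omega
  have hinj : ∀ i j, i < j → j ≤ L → w.getVert i ≠ w.getVert j := by
    intro i j hij hj h
    have hd := SimpleGraph.dist_le ((w.take i).append ((w.drop j).copy h.symm rfl))
    rw [SimpleGraph.Walk.length_append, SimpleGraph.Walk.length_copy,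
      SimpleGraph.Walk.take_length, SimpleGraph.Walk.drop_length, ← hw] at hd
    omega
  rcases Nat.lt_or_ge L 3 with h3 | h3
  · have hL0 : L ≠ 0 := fun h => hpq (by rw [h, h0] at hLq; exact hLq)
    have h1 := hsucc 0 (by omega)
    rw [h0] at h1
    obtain hL1 | hL2 : L = 1 ∨ L = 2 := by omega
    · rw [hL1] at hLq
      rw [zero_add, hLq] at h1
      exact Or.inl h1.1
    · have h2 := hsucc 1 (by omega)
      rw [hL2] at hLq
      rw [one_add_one_eq_two, hLq] at h2
      exact Or.inr (Or.inl ⟨_, h2.2.1, h1.1.symm, h2.1⟩)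
  · let f : Fin (L + 2) → V := fun i => if (i : ℕ) ≤ L then w.getVert i else a
    have hf : Function.Injective f := by
      intro i j hij
      have hi := i.isLt
      have hj := j.isLt
      rw [Fin.ext_iff]
      simp only [f] at hij
      split_ifs at hij with h1 h2 h2
      · rcases lt_trichotomy (i : ℕ) j with h | h | h
        · exact absurd hij (hinj _ _ h h2)
        · exact h
        · exact absurd hij.symm (hinj _ _ h h1)
      · exact absurd hij (hne _ h1)
      · exact absurd hij.symm (hne _ h2)
      · omega
    refine Or.inr (Or.inr ⟨L + 2, by omega, ⟨⟨⟨f, hf⟩, ?_⟩⟩⟩)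
    · intro i j
      have hi := i.isLt
      have hj := j.isLt
      have hend : ∀ k, k ≤ L → (G.Adj a (w.getVert k) ↔ k = 0 ∨ k = L) := by
        intro k hk
        rw [hN]
        refine or_congr ⟨fun h => ?_, fun h => h ▸ h0⟩ ⟨fun h => ?_, fun h => h ▸ hLq⟩
        · by_contra h'
          exact hinj 0 k (by omega) hk (h0.trans h.symm)
        · by_contra h'
          exact hinj k L (by omega) le_rfl (h.trans hLq.symm)
      have hpath : ∀ k l, k ≤ L → l ≤ L →
          (G.Adj (w.getVert k) (w.getVert l) ↔ k = l + 1 ∨ l = k + 1) := by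
        intro k l hk hl
        constructor
        · intro h
          rcases lt_trichotomy k l with h' | h' | h'
          · exact Or.inr (hskip _ _ h' hl h)
          · exact absurd (by rw [h']) h.ne
          · exact Or.inl (hskip _ _ h' hk h.symm)
        · rintro (rfl | rfl)
          · exact (hsucc l (by omega)).1.symm
          · exact (hsucc k (by omega)).1
      rw [cycleGraph_adj_iff_val (by omega)]
      change G.Adj (f i) (f j) ↔ _
      simp only [f]
      split_ifs with h1 h2 h2
      · rw [hpath _ _ h1 h2]
        omega
      · rw [G.adj_comm, hend _ h1]
        omega
      · rw [hend _ h2]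
        omega
      · simp only [SimpleGraph.irrefl, false_iff]
        omega

theorem not_reachable_avoid {a p : V} (hpa : p ≠ a) : ¬ (avoid G a).Reachable p a := by
  intro h
  obtain ⟨w⟩ := h.symm
  cases w with
  | nil => exact hpa rfl
  | cons h' _ => exact h'.2.1 rfl

variable [Fintype V]

/-- The degree conditions that characterise minimal non-mock-threshold graphs: all degrees and
codegrees are at least two, and every proper nonempty induced subgraph has a vertex of degree or
codegree at most one. -/
structure IsCritical (G : SimpleGraph V) : Prop where
  two_le : ∀ v, 2 ≤ degIn G univ v
  add_three_le : ∀ v, degIn G univ v + 3 ≤ Fintype.card V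
  exists_extreme : ∀ X : Finset V, X ≠ univ → X.Nonempty →
    ∃ v ∈ X, degIn G X v ≤ 1 ∨ #X ≤ degIn G X v + 2

theorem IsCritical.false_of_degIn (hG : IsCritical G) {X : Finset V} (hX : X ≠ univ)
    (hne : X.Nonempty) (h : ∀ v ∈ X, 2 ≤ degIn G X v ∧ degIn G X v + 3 ≤ #X) : False := by
  obtain ⟨v, hv, h'⟩ := hG.exists_extreme X hX hne
  have := h v hv
  omega

theorem exists_neighbors_of_degIn_eq_two {a : V} (h : degIn G univ a = 2) :
    ∃ p q, p ≠ q ∧ ∀ r, G.Adj a r ↔ r = p ∨ r = q := by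
  obtain ⟨p, q, hpq, h⟩ := card_eq_two.1 h
  refine ⟨p, q, hpq, fun r => ?_⟩
  have := congrArg (r ∈ ·) h
  simpa using this

theorem eq_or_eq_of_degIn_eq_two {a p q r : V} (h : degIn G univ a = 2) (hpq : p ≠ q)
    (hp : G.Adj a p) (hq : G.Adj a q) (hr : G.Adj a r) : r = p ∨ r = q := by
  obtain ⟨x, y, -, hxy⟩ := exists_neighbors_of_degIn_eq_two h
  grind

theorem exists_other_neighbor {a p : V} (h : degIn G univ a = 2) (hp : G.Adj a p) :
    ∃ q, q ≠ p ∧ ∀ r, G.Adj a r ↔ r = p ∨ r = q := by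
  obtain ⟨x, y, hne, hxy⟩ := exists_neighbors_of_degIn_eq_two h
  rcases (hxy p).1 hp with rfl | rfl
  · exact ⟨y, hne.symm, hxy⟩
  · exact ⟨x, hne, fun r => by rw [hxy, or_comm]⟩

theorem degIn_univ_compl (v : V) :
    degIn G univ v + degIn Gᶜ univ v + 1 = Fintype.card V :=
  degIn_add_card_compl (mem_univ v)

theorem IsCritical.compl (hG : IsCritical G) : IsCritical Gᶜ where
  two_le v := by
    have := hG.add_three_le v
    have := degIn_univ_compl (G := G) v
    omega
  add_three_le v := by
    have := hG.two_le v
    have := degIn_univ_compl (G := G) v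
    omega
  exists_extreme X hX hne := by
    obtain ⟨v, hv, h⟩ := hG.exists_extreme X hX hne
    refine ⟨v, hv, ?_⟩
    have := degIn_add_card_compl (G := G) hv
    omega

/-- Every vertex of a critical graph is adjacent to a vertex of degree two, or nonadjacent to a
vertex of codegree two. -/
theorem IsCritical.exists_adj_degIn_eq_two (hG : IsCritical G) (v : V) :
    (∃ a, degIn G univ a = 2 ∧ G.Adj a v) ∨ (∃ b, degIn Gᶜ univ b = 2 ∧ Gᶜ.Adj b v) := by
  have hn := hG.two_le v
  have hcard := hG.add_three_le v
  have hc : #(univ.erase v) + 1 = Fintype.card V := card_erase_add_one (mem_univ v)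
  obtain ⟨u, hu, h⟩ := hG.exists_extreme (univ.erase v) (by simp)
    (card_pos.1 (by omega))
  have hd := degIn_erase_add (G := G) (u := u) (mem_univ v)
  have hd' := degIn_univ_compl (G := G) u
  have h1 := hG.two_le u
  have h2 := hG.add_three_le u
  have huv : u ≠ v := by simpa using hu
  split_ifs at hd with huv'
  · exact Or.inl ⟨u, by omega, huv'⟩
  · exact Or.inr ⟨u, by omega, by simp [huv, huv']⟩

/-- A critical graph has no two nonadjacent sets of minimum degree two whose union is proper. -/
theorem IsCritical.false_of_two_cores (hG : IsCritical G) {Y Z : Finset V} (hY : Y.Nonempty)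
    (hZ : Z.Nonempty) (hdY : ∀ v ∈ Y, 2 ≤ degIn G Y v) (hdZ : ∀ v ∈ Z, 2 ≤ degIn G Z v)
    (hdisj : Disjoint Y Z) (hcross : ∀ y ∈ Y, ∀ z ∈ Z, ¬ G.Adj y z) (hne : Y ∪ Z ≠ univ) :
    False := by
  have hcard : #(Y ∪ Z) = #Y + #Z := card_union_of_disjoint hdisj
  obtain ⟨y, hy⟩ := hY
  obtain ⟨z, hz⟩ := hZ
  have hy3 := hdY y hy
  have hy3' := degIn_lt_card (G := G) hy
  have hz3 := hdZ z hz
  have hz3' := degIn_lt_card (G := G) hz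
  refine hG.false_of_degIn hne ⟨y, mem_union_left _ hy⟩ fun v hv => ?_
  rcases mem_union.1 hv with hv | hv
  · have h1 : degIn G Y v = degIn G (Y ∪ Z) v := degIn_congr subset_union_left
      fun u hu huv => (mem_union.1 hu).resolve_right fun hu => hcross v hv u hu huv
    have := hdY v hv
    have := degIn_lt_card (G := G) hv
    omega
  · have h1 : degIn G Z v = degIn G (Y ∪ Z) v := degIn_congr subset_union_right
      fun u hu huv => (mem_union.1 hu).resolve_left fun hu => hcross u hu v hv huv.symm
    have := hdZ v hv
    have := degIn_lt_card (G := G) hv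
    omega

theorem IsCritical.not_nonempty_cycleGraph_embedding (hG : IsCritical G)
    (hcyc : ∀ n, 5 ≤ n → ¬ Nonempty (G ≃g SimpleGraph.cycleGraph n)) {m : ℕ} (hm : 5 ≤ m) :
    ¬ Nonempty (SimpleGraph.cycleGraph m ↪g G) := by
  rintro ⟨φ⟩
  by_cases hS : univ.map φ.toEmbedding = univ
  · have hsurj : Function.Surjective φ := fun v => by
      have := mem_univ v
      rw [← hS] at this
      simpa using this
    exact hcyc m hm ⟨(RelIso.ofSurjective φ hsurj).symm⟩
  · refine hG.false_of_degIn hS ⟨φ ⟨0, by omega⟩, by simp⟩ fun v hv => ?_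
    obtain ⟨i, -, rfl⟩ := mem_map.1 hv
    have hdeg : degIn G (univ.map φ.toEmbedding) (φ.toEmbedding i) = 2 := by
      obtain ⟨k, rfl⟩ : ∃ k, m = k + 3 := ⟨m - 3, by omega⟩
      rw [← SimpleGraph.cycleGraph_degree_three_le (v := i), degIn, filter_map, card_map,
        ← SimpleGraph.card_neighborFinset_eq_degree]
      congr 1
      ext j
      simp
    rw [hdeg, card_map, card_univ, Fintype.card_fin]
    omega

/-- A vertex of degree two separating its neighbours `p` and `q` leaves a set of minimum degree two
on the side of `p`. -/
theorem exists_two_core_of_not_reachable {a p q : V} (hlo : ∀ v, 2 ≤ degIn G univ v)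
    (hpa : p ≠ a) (hN : ∀ r, G.Adj a r → r = p ∨ r = q)
    (hr : ¬ (avoid G a).Reachable p q) :
    ∃ Y : Finset V, (∀ v ∈ Y, (avoid G a).Reachable p v) ∧ Y.Nonempty ∧
      ∀ v ∈ Y, 2 ≤ degIn G Y v := by
  set K : Finset V := {v | (avoid G a).Reachable p v} with hK
  have hmem : ∀ v, v ∈ K ↔ (avoid G a).Reachable p v := by simp [hK]
  have hKa : ∀ v ∈ K, v ≠ a := by
    rintro v hv rfl
    exact not_reachable_avoid hpa ((hmem v).1 hv)
  have hp : p ∈ K := (hmem p).2 (SimpleGraph.Reachable.refl p)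
  have hdeg : ∀ v ∈ K, 2 ≤ degIn G K v + if v = p then 1 else 0 := by
    intro v hv
    have h1 : degIn G K v = degIn G (univ.erase a) v := by
      refine degIn_congr (fun u hu => by simp [hKa u hu]) fun u hu huv => ?_
      have hua : u ≠ a := by simpa using hu
      exact (hmem u).2 (((hmem v).1 hv).trans (SimpleGraph.Adj.reachable ⟨huv, hKa v hv, hua⟩))
    have h2 := degIn_erase_add (G := G) (u := v) (mem_univ a)
    have h3 := hlo v
    by_cases hva : G.Adj v a
    · have : v = p := by
        refine (hN v hva.symm).resolve_right ?_
        rintro rfl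
        exact hr ((hmem v).1 hv)
      simp only [hva, if_true] at h2
      simp only [this, if_true]
      subst this
      omega
    · simp only [hva, if_false] at h2
      omega
  have hsum := sum_le_sum hdeg
  rw [sum_add_distrib, sum_ite_eq' K p, if_pos hp, sum_const, smul_eq_mul, mul_comm] at hsum
  obtain ⟨Y, hY, hne, hd⟩ := exists_two_core K ⟨p, hp⟩ hsum
  exact ⟨Y, fun v hv => (hmem v).1 (hY hv), hne, hd⟩

/-- The neighbours of a vertex of degree two are adjacent or have a second common neighbour. -/
theorem IsCritical.adj_or_exists_adj (hG : IsCritical G)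
    (hcyc : ∀ n, 5 ≤ n → ¬ Nonempty (G ≃g SimpleGraph.cycleGraph n)) {a p q : V} (hpq : p ≠ q)
    (hN : ∀ r, G.Adj a r ↔ r = p ∨ r = q) :
    G.Adj p q ∨ ∃ u, u ≠ a ∧ G.Adj u p ∧ G.Adj u q := by
  by_cases hr : (avoid G a).Reachable p q
  · rcases adj_or_exists_adj_or_hole hpq hN hr with h | h | ⟨m, hm, h⟩
    · exact Or.inl h
    · exact Or.inr h
    · exact absurd h (hG.not_nonempty_cycleGraph_embedding hcyc hm)
  · exfalso
    have hpa : p ≠ a := fun h => (G.ne_of_adj ((hN p).2 (Or.inl rfl))) h.symm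
    have hqa : q ≠ a := fun h => (G.ne_of_adj ((hN q).2 (Or.inr rfl))) h.symm
    obtain ⟨Y, hYK, hY, hdY⟩ := exists_two_core_of_not_reachable hG.two_le hpa
      (fun r h => (hN r).1 h) hr
    obtain ⟨Z, hZK, hZ, hdZ⟩ := exists_two_core_of_not_reachable hG.two_le hqa
      (fun r h => ((hN r).1 h).symm) (fun h => hr h.symm)
    have haY : a ∉ Y := fun h => not_reachable_avoid hpa (hYK a h)
    have haZ : a ∉ Z := fun h => not_reachable_avoid hqa (hZK a h)
    refine hG.false_of_two_cores hY hZ hdY hdZ ?_ ?_ ?_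
    · rw [Finset.disjoint_left]
      exact fun v hv hv' => hr ((hYK v hv).trans (hZK v hv').symm)
    · intro y hy z hz hyz
      have : (avoid G a).Adj y z := ⟨hyz, fun h => haY (h ▸ hy), fun h => haZ (h ▸ hz)⟩
      exact hr (((hYK y hy).trans this.reachable).trans (hZK z hz).symm)
    · intro h
      have := mem_univ a
      rw [← h] at this
      simp [haY, haZ] at this

/-- A critical graph does not contain two triangles hanging off a common vertex. -/
theorem IsCritical.false_of_two_triangles (hG : IsCritical G) (hn : 8 ≤ Fintype.card V)
    {h u c u' c' : V} (hu : degIn G univ u = 2) (hc : degIn G univ c = 2)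
    (hu' : degIn G univ u' = 2) (hc' : degIn G univ c' = 2) (huc : G.Adj u c) (huh : G.Adj u h)
    (hch : G.Adj c h) (huc' : G.Adj u' c') (huh' : G.Adj u' h) (hch' : G.Adj c' h)
    (h1 : u' ≠ u) (h2 : u' ≠ c) : False := by
  have nu : ∀ r, G.Adj u r → r = c ∨ r = h := fun r => eq_or_eq_of_degIn_eq_two hu hch.ne huc huh
  have nc : ∀ r, G.Adj c r → r = u ∨ r = h :=
    fun r => eq_or_eq_of_degIn_eq_two hc huh.ne huc.symm hch
  have nu' : ∀ r, G.Adj u' r → r = c' ∨ r = h :=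
    fun r => eq_or_eq_of_degIn_eq_two hu' hch'.ne huc' huh'
  have nc' : ∀ r, G.Adj c' r → r = u' ∨ r = h :=
    fun r => eq_or_eq_of_degIn_eq_two hc' huh'.ne huc'.symm hch'
  have h3 : c' ≠ u := by
    rintro rfl
    rcases nu u' huc'.symm with e | e
    · exact h2 e
    · exact huh'.ne e
  have h4 : c' ≠ c := by
    rintro rfl
    rcases nc u' huc'.symm with e | e
    · exact h1 e
    · exact huh'.ne e
  set X : Finset V := (univ.erase u).erase c with hX
  have hcu : c ∈ univ.erase u := by simp [huc.ne']
  have hmem : ∀ v, v ∈ X ↔ v ≠ c ∧ v ≠ u := by simp [hX]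
  have hcard : #X + 2 = Fintype.card V := by
    have e1 : #X + 1 = #(univ.erase u) := card_erase_add_one hcu
    have e2 : #(univ.erase u) + 1 = Fintype.card V := card_erase_add_one (mem_univ u)
    omega
  have hdeg : ∀ v, degIn G X v + (if G.Adj v c then 1 else 0) + (if G.Adj v u then 1 else 0)
      = degIn G univ v := by
    intro v
    rw [degIn_erase_add hcu, degIn_erase_add (mem_univ u)]
  have hu'X : u' ∈ X := (hmem _).2 ⟨h2, h1⟩
  have hc'X : c' ∈ X := (hmem _).2 ⟨h4, h3⟩
  refine hG.false_of_degIn (X := X) (fun h => ?_) ⟨u', hu'X⟩ fun v hv => ?_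
  · have := (hmem u).1 (h ▸ mem_univ u)
    exact this.2 rfl
  have hvX := (hmem v).1 hv
  by_cases hvh : v = h
  · subst hvh
    have := hdeg v
    rw [if_pos hch.symm, if_pos huh.symm] at this
    have := hG.add_three_le v
    have := two_le_degIn hu'X hc'X huc'.ne huh'.symm hch'.symm
    omega
  · have hvc : ¬ G.Adj v c := fun e => by rcases nc v e.symm with e | e <;> simp_all
    have hvu : ¬ G.Adj v u := fun e => by rcases nu v e.symm with e | e <;> simp_all
    have hd := hdeg v
    rw [if_neg hvc, if_neg hvu] at hd
    have := hG.two_le v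
    refine ⟨by omega, ?_⟩
    by_cases hvu' : v = u'
    · subst hvu'
      omega
    by_cases hvc' : v = c'
    · subst hvc'
      omega
    exact degIn_add_three_le hv hu'X hc'X huc'.ne (Ne.symm hvu') (Ne.symm hvc')
      (fun e => by rcases nu' v e.symm with e | e <;> contradiction)
      (fun e => by rcases nc' v e.symm with e | e <;> contradiction)

/-- If `h` is adjacent to everything outside `F` and every vertex outside `F` has a neighbour of
degree two, then up to two vertices everything is `h`, in `F`, or adjacent to a vertex of degree
two in `F`. -/
theorem IsCritical.exists_cover (hG : IsCritical G) (hn : 8 ≤ Fintype.card V) {h : V}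
    {F : Finset V} (hh : degIn G univ h ≠ 2) (hadj : ∀ v ∉ F, v ≠ h → G.Adj v h)
    (hA : ∀ v ∉ F, ∃ a, degIn G univ a = 2 ∧ G.Adj a v) :
    ∃ c c' : V, ∀ v, v = h ∨ v ∈ F ∨ (∃ f ∈ F, degIn G univ f = 2 ∧ G.Adj f v) ∨
      v = c ∨ v = c' := by
  have key : ∀ v, v = h ∨ v ∈ F ∨ (∃ f ∈ F, degIn G univ f = 2 ∧ G.Adj f v) ∨
      ∃ a, degIn G univ v = 2 ∧ degIn G univ a = 2 ∧ G.Adj v a ∧ G.Adj v h ∧ G.Adj a h := by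
    intro v
    by_cases hvh : v = h
    · exact Or.inl hvh
    by_cases hvF : v ∈ F
    · exact Or.inr (Or.inl hvF)
    obtain ⟨a, ha, hav⟩ := hA v hvF
    by_cases haF : a ∈ F
    · exact Or.inr (Or.inr (Or.inl ⟨a, haF, ha, hav⟩))
    have hah : a ≠ h := fun e => hh (e ▸ ha)
    have haadj := hadj a haF hah
    obtain ⟨b, hb, hba⟩ := hA a haF
    rcases eq_or_eq_of_degIn_eq_two ha hvh hav haadj hba.symm with rfl | rfl
    · exact Or.inr (Or.inr (Or.inr ⟨a, hb, ha, hba, hadj b hvF hvh, haadj⟩))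
    · exact absurd hb hh
  by_cases hT : ∃ u c, degIn G univ u = 2 ∧ degIn G univ c = 2 ∧ G.Adj u c ∧ G.Adj u h ∧
      G.Adj c h
  · obtain ⟨u, c, hu, hc, huc, huh, hch⟩ := hT
    refine ⟨u, c, fun v => ?_⟩
    rcases key v with e | e | e | ⟨a, hv, ha, hva, hvh, hah⟩
    · exact Or.inl e
    · exact Or.inr (Or.inl e)
    · exact Or.inr (Or.inr (Or.inl e))
    · by_contra hcon
      push Not at hcon
      exact hG.false_of_two_triangles hn hu hc hv ha huc huh hch hva hvh hah
        hcon.2.2.2.1 hcon.2.2.2.2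
  · refine ⟨h, h, fun v => ?_⟩
    rcases key v with e | e | e | ⟨a, hv, ha, hva, hvh, hah⟩
    · exact Or.inl e
    · exact Or.inr (Or.inl e)
    · exact Or.inr (Or.inr (Or.inl e))
    · exact absurd ⟨v, a, hv, ha, hva, hvh, hah⟩ hT

/-- The neighbours of `f`, when it has degree two, are among two vertices. -/
theorem exists_forall_adj_eq_or_eq (f : V) :
    ∃ p q, ∀ r, degIn G univ f = 2 → G.Adj f r → r = p ∨ r = q := by
  by_cases hf : degIn G univ f = 2
  · obtain ⟨p, q, -, h⟩ := exists_neighbors_of_degIn_eq_two hf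
    exact ⟨p, q, fun r _ hr => (h r).1 hr⟩
  · exact ⟨f, f, fun r h => absurd h hf⟩

theorem card_le_length {l : List V} (h : ∀ v, v ∈ l) : Fintype.card V ≤ l.length := by
  rw [← card_univ]
  exact (card_le_card fun v _ => List.mem_toFinset.2 (h v)).trans l.toFinset_card_le

/-- A critical graph with exactly one vertex of codegree two has at most ten vertices. -/
theorem IsCritical.card_le_of_unique (hG : IsCritical G) {b : V} (hb : degIn Gᶜ univ b = 2)
    (huniq : ∀ x, degIn Gᶜ univ x = 2 → x = b) : Fintype.card V ≤ 10 := by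
  by_contra hn
  have hbd := degIn_univ_compl (G := G) b
  obtain ⟨p, q, -, hpq⟩ := exists_neighbors_of_degIn_eq_two hb
  obtain ⟨p₁, p₂, hp⟩ := exists_forall_adj_eq_or_eq (G := G) p
  obtain ⟨q₁, q₂, hq⟩ := exists_forall_adj_eq_or_eq (G := G) q
  obtain ⟨c, c', hcov⟩ := hG.exists_cover (by omega) (h := b) (F := {p, q}) (by omega)
    (fun v hv hvb => by
      by_contra hadj
      have := (hpq v).1 ⟨Ne.symm hvb, fun e => hadj e.symm⟩
      simp at hv
      tauto)
    (fun v hv => by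
      refine (hG.exists_adj_degIn_eq_two v).resolve_right ?_
      rintro ⟨x, hx, hxv⟩
      rw [huniq x hx, hpq] at hxv
      simp at hv
      tauto)
  have := card_le_length (l := [b, p, q, p₁, p₂, q₁, q₂, c, c']) fun v => by
    have := hcov v
    have := hp v
    have := hq v
    simp only [mem_insert, mem_singleton, List.mem_cons, List.not_mem_nil] at *
    grind
  simp at this
  omega

/-- The case of two adjacent vertices of degree two whose other neighbours are distinct and of
larger degree. -/
theorem IsCritical.card_le_of_adj (hG : IsCritical G)
    (hA : ∀ v, ∃ a, degIn G univ a = 2 ∧ G.Adj a v) {a a' x y : V}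
    (ha : ∀ r, G.Adj a r ↔ r = a' ∨ r = x) (ha' : ∀ r, G.Adj a' r ↔ r = a ∨ r = y)
    (hx : degIn G univ x ≠ 2) (hy : degIn G univ y ≠ 2) (hxy : x ≠ y) :
    Fintype.card V ≤ 10 := by
  by_contra hn
  have haa' : G.Adj a a' := (ha a').2 (Or.inl rfl)
  set X : Finset V := (univ.erase a).erase a' with hX
  have hmem : ∀ v, v ∈ X ↔ v ≠ a' ∧ v ≠ a := by simp [hX]
  have haX : a' ∈ univ.erase a := by simp [haa'.ne']
  have hcard : #X + 2 = Fintype.card V := by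
    have e1 : #X + 1 = #(univ.erase a) := card_erase_add_one haX
    have e2 : #(univ.erase a) + 1 = Fintype.card V := card_erase_add_one (mem_univ a)
    omega
  have hdeg : ∀ v, degIn G X v + (if G.Adj v a' then 1 else 0) + (if G.Adj v a then 1 else 0)
      = degIn G univ v := by
    intro v
    rw [degIn_erase_add haX, degIn_erase_add (mem_univ a)]
  have hlow : ∀ v ∈ X, 2 ≤ degIn G X v := by
    intro v hv
    have hvX := (hmem v).1 hv
    have h1 := hdeg v
    have h2 := hG.two_le v
    have e1 : G.Adj v a → v = x := fun e => ((ha v).1 e.symm).resolve_left hvX.1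
    have e2 : G.Adj v a' → v = y := fun e => ((ha' v).1 e.symm).resolve_left hvX.2
    by_cases c1 : G.Adj v a <;> by_cases c2 : G.Adj v a'
    · exact absurd ((e1 c1).symm.trans (e2 c2)) hxy
    · rw [if_pos c1, if_neg c2] at h1
      rw [← e1 c1] at hx
      omega
    · rw [if_neg c1, if_pos c2] at h1
      rw [← e2 c2] at hy
      omega
    · rw [if_neg c1, if_neg c2] at h1
      omega
  obtain ⟨h, hhX, hh⟩ := hG.exists_extreme X
    (fun e => ((hmem a).1 (e ▸ mem_univ a)).2 rfl) (card_pos.1 (by omega))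
  have hhl := hlow h hhX
  have hco := degIn_add_card_compl (G := G) hhX
  have hle := degIn_mono (G := G) (subset_univ X) h
  obtain ⟨e, he⟩ := exists_forall_eq_of_degIn_le_one (G := Gᶜ) (X := X) (v := h) (by omega)
  obtain ⟨e₁, e₂, hee⟩ := exists_forall_adj_eq_or_eq (G := G) e
  obtain ⟨c, c', hcov⟩ := hG.exists_cover (by omega) (h := h) (F := {a, a', e}) (by omega)
    (fun v hv hvh => by
      simp only [mem_insert, mem_singleton, not_or] at hv
      by_contra hadj
      exact hv.2.2 (he v ((hmem v).2 ⟨hv.2.1, hv.1⟩)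
        ⟨Ne.symm hvh, fun e => hadj e.symm⟩))
    (fun v _ => hA v)
  have := card_le_length (l := [h, a, a', e, x, y, e₁, e₂, c, c']) fun v => by
    have := hcov v
    have := ha v
    have := ha' v
    have := hee v
    simp only [mem_insert, mem_singleton, List.mem_cons, List.not_mem_nil] at *
    grind
  simp at this
  omega

/-- A critical graph with a vertex of degree at least three and a vertex of degree two outside
`Z` has an edge leaving `Z`. -/
theorem IsCritical.false_of_closed (hG : IsCritical G) {Z : Finset V} (hZ : Z.Nonempty)
    (hclosed : ∀ z ∈ Z, ∀ u, G.Adj z u → u ∈ Z) {w d : V} (hw : w ∉ Z)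
    (hwd : degIn G univ w ≠ 2) (hd : d ∉ Z) (hdd : degIn G univ d = 2) : False := by
  have hX : ∀ v ∈ Zᶜ, degIn G Zᶜ v = degIn G univ v := fun v hv =>
    degIn_congr (subset_univ _) fun u _ huv => by
      rw [mem_compl] at hv ⊢
      exact fun hu => hv (hclosed u hu v huv.symm)
  have hdX : d ∈ Zᶜ := by simpa using hd
  have hwX : w ∈ Zᶜ := by simpa using hw
  have hsum : ∑ v ∈ Zᶜ, 2 < ∑ v ∈ Zᶜ, degIn G Zᶜ v := by
    refine sum_lt_sum (fun v hv => ?_) ⟨w, hwX, ?_⟩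
    · rw [hX v hv]
      exact hG.two_le v
    · rw [hX w hwX]
      have := hG.two_le w
      omega
  rw [sum_const, smul_eq_mul, sum_degIn_erase hdX, hX d hdX, hdd,
    ← card_erase_add_one hdX] at hsum
  have hwd' : w ≠ d := fun h => hwd (h ▸ hdd)
  obtain ⟨Y, hY, hne, hdY⟩ := exists_two_core (G := G) (Zᶜ.erase d)
    ⟨w, mem_erase.2 ⟨hwd', hwX⟩⟩ (by omega)
  have hYZ : ∀ y ∈ Y, y ∉ Z := fun y hy => by
    have := mem_of_mem_erase (hY hy)
    simpa using this
  refine hG.false_of_two_cores hne hZ hdY (fun v hv => ?_) ?_ ?_ ?_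
  · rw [degIn_congr (subset_univ Z) fun u _ huv => hclosed v hv u huv]
    exact hG.two_le v
  · rw [Finset.disjoint_left]
    exact hYZ
  · exact fun y hy z hz hyz => hYZ y hy (hclosed z hz y hyz.symm)
  · intro h
    have := mem_univ d
    rw [← h, mem_union] at this
    rcases this with h | h
    · exact notMem_erase d _ (hY h)
    · exact hd h

/-- A short cycle `Z` through `w` all of whose other vertices have degree two, together with the
two neighbours of `w` on it. -/
structure IsLoop (G : SimpleGraph V) (w : V) (Z : Finset V) (c c' : V) : Prop where
  mem : w ∈ Z
  card_le : #Z ≤ 4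
  ne : c ≠ c'
  mem_left : c ∈ Z
  mem_right : c' ∈ Z
  adj_left : G.Adj w c
  adj_right : G.Adj w c'
  closed : ∀ z ∈ Z, z ≠ w → degIn G univ z = 2 ∧ ∀ u, G.Adj z u → u ∈ Z

theorem ne_univ_of_card_lt {X : Finset V} (h : #X < Fintype.card V) : X ≠ univ := by
  rintro rfl
  exact absurd h (by simp)

theorem IsCritical.false_of_isLoop (hG : IsCritical G) (hn : 9 ≤ Fintype.card V)
    {w₁ w₂ c₁ c₁' c₂ c₂' : V} {Z₁ Z₂ : Finset V} (h₁ : IsLoop G w₁ Z₁ c₁ c₁')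
    (h₂ : IsLoop G w₂ Z₂ c₂ c₂') (hw : w₁ ≠ w₂) (hd₁ : degIn G univ w₁ ≠ 2)
    (hd₂ : degIn G univ w₂ ≠ 2) : False := by
  have hw₁ : w₁ ∉ Z₂ := fun h => hd₁ (h₂.closed _ h hw).1
  have hw₂ : w₂ ∉ Z₁ := fun h => hd₂ (h₁.closed _ h hw.symm).1
  have n₁ : ∀ z ∈ Z₁, z ≠ w₁ → ¬ G.Adj w₂ z :=
    fun z hz hzw h => hw₂ ((h₁.closed z hz hzw).2 _ h.symm)
  have n₂ : ∀ z ∈ Z₂, z ≠ w₂ → ¬ G.Adj w₁ z :=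
    fun z hz hzw h => hw₁ ((h₂.closed z hz hzw).2 _ h.symm)
  have s₁ : Z₁ ⊆ Z₁ ∪ Z₂ := subset_union_left
  have s₂ : Z₂ ⊆ Z₁ ∪ Z₂ := subset_union_right
  have hcard : #(Z₁ ∪ Z₂) ≤ 8 := (card_union_le _ _).trans
    (by have := h₁.card_le; have := h₂.card_le; omega)
  have hw₁d : 2 ≤ degIn G (Z₁ ∪ Z₂) w₁ :=
    two_le_degIn (s₁ h₁.mem_left) (s₁ h₁.mem_right) h₁.ne h₁.adj_left h₁.adj_right
  have hw₂d : 2 ≤ degIn G (Z₁ ∪ Z₂) w₂ :=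
    two_le_degIn (s₂ h₂.mem_left) (s₂ h₂.mem_right) h₂.ne h₂.adj_left h₂.adj_right
  have hw₁u : degIn G (Z₁ ∪ Z₂) w₁ + 3 ≤ #(Z₁ ∪ Z₂) :=
    degIn_add_three_le (s₁ h₁.mem) (s₂ h₂.mem_left) (s₂ h₂.mem_right) h₂.ne
      (fun e => hw₁ (e ▸ h₂.mem_left)) (fun e => hw₁ (e ▸ h₂.mem_right))
      (n₂ _ h₂.mem_left h₂.adj_left.ne') (n₂ _ h₂.mem_right h₂.adj_right.ne')
  have hw₂u : degIn G (Z₁ ∪ Z₂) w₂ + 3 ≤ #(Z₁ ∪ Z₂) :=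
    degIn_add_three_le (s₂ h₂.mem) (s₁ h₁.mem_left) (s₁ h₁.mem_right) h₁.ne
      (fun e => hw₂ (e ▸ h₁.mem_left)) (fun e => hw₂ (e ▸ h₁.mem_right))
      (n₁ _ h₁.mem_left h₁.adj_left.ne') (n₁ _ h₁.mem_right h₁.adj_right.ne')
  refine hG.false_of_degIn (ne_univ_of_card_lt (X := Z₁ ∪ Z₂) (by omega)) ⟨w₁, s₁ h₁.mem⟩
    fun v hv => ?_
  by_cases e₁ : v = w₁
  · subst e₁
    exact ⟨hw₁d, hw₁u⟩
  by_cases e₂ : v = w₂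
  · subst e₂
    exact ⟨hw₂d, hw₂u⟩
  have : degIn G (Z₁ ∪ Z₂) v = degIn G univ v := by
    refine degIn_congr (subset_univ _) fun u _ huv => ?_
    rcases mem_union.1 hv with h | h
    · exact s₁ ((h₁.closed v h e₁).2 u huv)
    · exact s₂ ((h₂.closed v h e₂).2 u huv)
  have hdv : degIn G univ v = 2 := by
    rcases mem_union.1 hv with h | h
    · exact (h₁.closed v h e₁).1
    · exact (h₂.closed v h e₂).1
  omega

/-- If the neighbours of a vertex `a` of degree two have degree two, then `a` lies on a component of
at most four vertices, or on a four-cycle whose fourth vertex `u` has larger degree. -/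
theorem IsCritical.exists_closed_or_exists_adj (hG : IsCritical G)
    (hcyc : ∀ n, 5 ≤ n → ¬ Nonempty (G ≃g SimpleGraph.cycleGraph n)) {a p q : V} (hpq : p ≠ q)
    (hN : ∀ r, G.Adj a r ↔ r = p ∨ r = q) (ha : degIn G univ a = 2)
    (hp : degIn G univ p = 2) (hq : degIn G univ q = 2) :
    (∃ Z : Finset V, a ∈ Z ∧ #Z ≤ 4 ∧
      ∀ z ∈ Z, degIn G univ z = 2 ∧ ∀ u, G.Adj z u → u ∈ Z) ∨
      ∃ u, degIn G univ u ≠ 2 ∧ (∀ r, G.Adj p r ↔ r = a ∨ r = u) ∧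
        ∀ r, G.Adj q r ↔ r = a ∨ r = u := by
  have hpa : G.Adj p a := ((hN p).2 (Or.inl rfl)).symm
  have hqa : G.Adj q a := ((hN q).2 (Or.inr rfl)).symm
  obtain ⟨p', hp', Np⟩ := exists_other_neighbor hp hpa
  obtain ⟨q', hq', Nq⟩ := exists_other_neighbor hq hqa
  rcases hG.adj_or_exists_adj hcyc hpq hN with h | ⟨u, hua, hup, huq⟩
  · left
    refine ⟨{a, p, q}, by simp, card_le_three.trans (by norm_num), ?_⟩
    have := (Np q).1 h
    have := (Nq p).1 h.symm
    have := hpa.ne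
    have := hqa.ne
    simp only [mem_insert, mem_singleton]
    grind
  · obtain rfl : u = p' := ((Np u).1 hup.symm).resolve_left hua
    obtain rfl : u = q' := ((Nq u).1 huq.symm).resolve_left hua
    by_cases hu : degIn G univ u = 2
    · left
      have Nu := fun r => eq_or_eq_of_degIn_eq_two (r := r) hu hpq hup huq
      refine ⟨{a, p, q, u}, by simp, card_le_four, ?_⟩
      simp only [mem_insert, mem_singleton]
      grind
    · exact Or.inr ⟨u, hu, Np, Nq⟩

theorem IsCritical.exists_isLoop (hG : IsCritical G) (hn : 11 ≤ Fintype.card V)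
    (hcyc : ∀ n, 5 ≤ n → ¬ Nonempty (G ≃g SimpleGraph.cycleGraph n))
    (hA : ∀ v, ∃ a, degIn G univ a = 2 ∧ G.Adj a v) {w : V} (hw : degIn G univ w ≠ 2) :
    ∃ Z c c', IsLoop G w Z c c' := by
  obtain ⟨a, ha, haw⟩ := hA w
  obtain ⟨a', ha', haa'⟩ := hA a
  have hwa' : a' ≠ w := fun h => hw (h ▸ ha')
  have Na := fun r => eq_or_eq_of_degIn_eq_two (r := r) ha hwa' haa'.symm haw
  obtain ⟨y, hya, Na'⟩ := exists_other_neighbor ha' haa'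
  have hay : G.Adj a' y := (Na' y).2 (Or.inr rfl)
  by_cases hy : degIn G univ y = 2
  · have hwy : y ≠ w := fun h => hw (h ▸ hy)
    rcases hG.adj_or_exists_adj hcyc hya.symm Na' with h | ⟨u, hua', hua, huy⟩
    · rcases Na y h with h | h
      · exact absurd h hay.ne'
      · exact absurd h hwy
    · obtain rfl : u = w := (Na u hua.symm).resolve_left hua'
      have Ny := fun r => eq_or_eq_of_degIn_eq_two (r := r) hy hwa' hay.symm huy.symm
      refine ⟨{u, a, a', y}, a, y, by simp, card_le_four, hya.symm, by simp, by simp, hua, huy, ?_⟩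
      simp only [mem_insert, mem_singleton]
      grind
  · obtain rfl : y = w := by
      by_contra hne
      have := hG.card_le_of_adj hA (fun r => ⟨Na r, fun h => by
        rcases h with rfl | rfl
        · exact haa'.symm
        · exact haw⟩) Na' hw hy (Ne.symm hne)
      omega
    refine ⟨{y, a, a'}, a, a', by simp, card_le_three.trans (by norm_num), haa'.ne', by simp,
      by simp, haw.symm, hay.symm, ?_⟩
    simp only [mem_insert, mem_singleton]
    grind

/-- A critical graph without vertices of codegree two has at most ten vertices. -/
theorem IsCritical.card_le_of_forall_ne (hG : IsCritical G)
    (hcyc : ∀ n, 5 ≤ n → ¬ Nonempty (G ≃g SimpleGraph.cycleGraph n))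
    (hB : ∀ b, degIn Gᶜ univ b ≠ 2) : Fintype.card V ≤ 10 := by
  by_contra hn
  have hA : ∀ v, ∃ a, degIn G univ a = 2 ∧ G.Adj a v := fun v =>
    (hG.exists_adj_degIn_eq_two v).resolve_right fun ⟨b, hb, _⟩ => hB b hb
  by_cases hreg : ∀ v, degIn G univ v = 2
  · have hclosed : ∀ v, ∃ Z : Finset V, v ∈ Z ∧ #Z ≤ 4 ∧ ∀ z ∈ Z, ∀ u, G.Adj z u → u ∈ Z := by
      intro v
      obtain ⟨p, q, hpq, hN⟩ := exists_neighbors_of_degIn_eq_two (hreg v)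
      rcases hG.exists_closed_or_exists_adj hcyc hpq hN (hreg v) (hreg p) (hreg q) with
        ⟨Z, hvZ, hZ, cZ⟩ | ⟨u, hu, -⟩
      · exact ⟨Z, hvZ, hZ, fun z hz => (cZ z hz).2⟩
      · exact absurd (hreg u) hu
    have : Nonempty V := Fintype.card_pos_iff.1 (by omega)
    obtain ⟨Y, hvY, hY, cY⟩ := hclosed (Classical.arbitrary V)
    obtain ⟨d, hd⟩ : ∃ d, d ∉ Y := by
      by_contra! h
      exact ne_univ_of_card_lt (X := Y) (by omega) (eq_univ_of_forall h)
    obtain ⟨Z, hdZ, hZ, cZ⟩ := hclosed d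
    refine hG.false_of_two_cores (Y := Y) (Z := Z \ Y) ⟨_, hvY⟩ ⟨d, mem_sdiff.2 ⟨hdZ, hd⟩⟩
      (fun v hv => ?_) (fun v hv => ?_) disjoint_sdiff
      (fun y hy z hz hyz => (mem_sdiff.1 hz).2 (cY y hy z hyz)) (ne_univ_of_card_lt ?_)
    · rw [degIn_congr (subset_univ Y) fun u _ huv => cY v hv u huv, hreg]
    · rw [mem_sdiff] at hv
      rw [degIn_congr (subset_univ _) fun u _ huv => mem_sdiff.2
        ⟨cZ v hv.1 u huv, fun hu => hv.2 (cY u hu v huv.symm)⟩, hreg]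
    · have := card_union_le Y (Z \ Y)
      have := card_le_card (sdiff_subset : Z \ Y ⊆ Z)
      omega
  · push Not at hreg
    obtain ⟨w, hw⟩ := hreg
    obtain ⟨Z, c, c', hZ⟩ := hG.exists_isLoop (by omega) hcyc hA hw
    have huniq : ∀ v, v ≠ w → degIn G univ v = 2 := by
      intro v hv
      by_contra hvd
      obtain ⟨Z', d, d', hZ'⟩ := hG.exists_isLoop (by omega) hcyc hA hvd
      exact hG.false_of_isLoop (by omega) hZ' hZ hv hvd hw
    obtain ⟨d, hd, hdw⟩ := hA w
    have hfar : ∀ x, Gᶜ.Adj w x → ∃ p q, p ≠ q ∧ (∀ r, G.Adj x r ↔ r = p ∨ r = q) ∧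
        (∀ r, G.Adj p r ↔ r = x ∨ r = w) ∧ ∀ r, G.Adj q r ↔ r = x ∨ r = w := by
      intro x hx
      rw [SimpleGraph.compl_adj] at hx
      have hxd := huniq x (Ne.symm hx.1)
      obtain ⟨p, q, hpq, hN⟩ := exists_neighbors_of_degIn_eq_two hxd
      have hpw : p ≠ w := by
        rintro rfl
        exact hx.2 ((hN p).2 (Or.inl rfl)).symm
      have hqw : q ≠ w := by
        rintro rfl
        exact hx.2 ((hN q).2 (Or.inr rfl)).symm
      rcases hG.exists_closed_or_exists_adj hcyc hpq hN hxd (huniq p hpw) (huniq q hqw) with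
        ⟨Y, hxY, -, cY⟩ | ⟨u, hu, Np, Nq⟩
      · exfalso
        have hwY : w ∉ Y := fun h => hw (cY w h).1
        exact hG.false_of_closed ⟨x, hxY⟩ (fun z hz => (cY z hz).2) hwY hw
          (fun h => hwY ((cY d h).2 w hdw)) hd
      · obtain rfl : u = w := by
          by_contra h
          exact hu (huniq u h)
        exact ⟨p, q, hpq, hN, Np, Nq⟩
    have hco := degIn_univ_compl (G := G) w
    have h3 := hG.add_three_le w
    obtain ⟨x, y, hxy, hx, hy⟩ := exists_ne_of_one_lt_degIn (G := Gᶜ) (X := univ) (v := w)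
      (by omega)
    obtain ⟨p, q, hpq, Nx, Np, Nq⟩ := hfar x hx
    obtain ⟨s, t, hst, Ny, Ns, Nt⟩ := hfar y hy
    rw [SimpleGraph.compl_adj] at hx hy
    set X : Finset V := [w, x, p, q, y, s, t].toFinset with hX
    have hwp : G.Adj w p := ((Np w).2 (Or.inr rfl)).symm
    have hwq : G.Adj w q := ((Nq w).2 (Or.inr rfl)).symm
    have hwX : w ∈ X := by simp [hX]
    have hpX : p ∈ X := by simp [hX]
    have hqX : q ∈ X := by simp [hX]
    have hxX : x ∈ X := by simp [hX]
    have hyX : y ∈ X := by simp [hX]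
    have hlow := two_le_degIn hpX hqX hpq hwp hwq
    have hup := degIn_add_three_le hwX hxX hyX hxy (Ne.symm hx.1) (Ne.symm hy.1) hx.2 hy.2
    refine hG.false_of_degIn (X := X) (ne_univ_of_card_lt ?_) ⟨w, hwX⟩ fun v hv => ?_
    · have : #X ≤ 7 := List.toFinset_card_le _
      omega
    by_cases hvw : v = w
    · subst hvw
      exact ⟨hlow, hup⟩
    · rw [degIn_congr (subset_univ X) fun u _ huv => by
        simp only [hX, List.mem_toFinset, List.mem_cons, List.not_mem_nil] at hv ⊢
        grind, huniq v hvw]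
      omega

theorem sum_degIn_add_sum_degIn_compl {S : Finset V} (T : Finset V)
    (h : ∀ s ∈ S, degIn G univ s = 2) :
    ∑ s ∈ S, degIn G T s + ∑ s ∈ S, degIn G Tᶜ s = 2 * #S := by
  rw [← sum_add_distrib, mul_comm, ← smul_eq_mul, ← sum_const]
  refine sum_congr rfl fun s hs => ?_
  rw [← h s hs]
  unfold degIn
  rw [← card_union_of_disjoint (disjoint_filter_filter disjoint_compl_right), ← filter_union,
    union_compl]

theorem le_ten_of_mul_eq {m k e f x y : ℕ} (hm : 2 ≤ m) (hk : 2 ≤ k) (hef : e + f = m * k)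
    (he : e ≤ 2 * m) (hf : f ≤ 2 * k) (hxk : x ≤ k) (hxe : x ≤ e) (hym : y ≤ m) (hyf : y ≤ f) :
    x + (2 * m - e) + y + (2 * k - f) ≤ 10 := by
  obtain rfl | hk := hk.eq_or_lt
  · omega
  obtain rfl | hm := hm.eq_or_lt
  · omega
  obtain ⟨i, rfl⟩ := Nat.exists_eq_add_of_le (show 3 ≤ m from hm)
  obtain ⟨j, rfl⟩ := Nat.exists_eq_add_of_le (show 3 ≤ k from hk)
  have : (3 + i) * (3 + j) = 9 + 3 * i + 3 * j + i * j := by ring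
  omega

/-- Double counting the pairs between vertices of degree two and vertices of codegree two. -/
theorem IsCritical.card_le_of_two_le (hG : IsCritical G)
    (hA : 2 ≤ #{a | degIn G univ a = 2}) (hB : 2 ≤ #{b | degIn Gᶜ univ b = 2}) :
    Fintype.card V ≤ 10 := by
  by_contra! hn
  obtain ⟨A, hA, hAm⟩ : ∃ A : Finset V, 2 ≤ #A ∧ ∀ a, a ∈ A ↔ degIn G univ a = 2 :=
    ⟨_, hA, by simp⟩
  obtain ⟨B, hB, hBm⟩ : ∃ B : Finset V, 2 ≤ #B ∧ ∀ b, b ∈ B ↔ degIn Gᶜ univ b = 2 :=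
    ⟨_, hB, by simp⟩
  have hdisj : Disjoint A B := disjoint_left.2 fun v ha hb => by
    have := degIn_univ_compl (G := G) v
    rw [hAm] at ha
    rw [hBm] at hb
    omega
  have hcover : (univ : Finset V) ⊆
      (nbrsIn G B A ∪ nbrsIn G Bᶜ A) ∪ (nbrsIn Gᶜ A B ∪ nbrsIn Gᶜ Aᶜ B) := by
    intro v _
    simp only [nbrsIn, mem_union, mem_filter, mem_compl]
    rcases hG.exists_adj_degIn_eq_two v with ⟨a, ha, hav⟩ | ⟨b, hb, hbv⟩
    · have := (hAm a).2 ha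
      by_cases v ∈ B <;> grind
    · have := (hBm b).2 hb
      by_cases v ∈ A <;> grind
  have hcard := (card_le_card hcover).trans ((card_union_le _ _).trans
    (add_le_add (card_union_le _ _) (card_union_le _ _)))
  rw [card_univ] at hcard
  have he := sum_degIn_add_sum_degIn_compl B fun a ha => (hAm a).1 ha
  have hf := sum_degIn_add_sum_degIn_compl A fun b hb => (hBm b).1 hb
  have hef := sum_degIn_add_sum_degIn_of_disjoint (G := G) hdisj
  have h1 := card_nbrsIn_le_sum (G := G) B A
  have h2 := card_nbrsIn_le_sum (G := G) Bᶜ A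
  have h3 := card_nbrsIn_le_sum (G := Gᶜ) A B
  have h4 := card_nbrsIn_le_sum (G := Gᶜ) Aᶜ B
  have h5 := card_nbrsIn_le (G := G) B A
  have h6 := card_nbrsIn_le (G := Gᶜ) A B
  have := le_ten_of_mul_eq hA hB hef (x := #(nbrsIn G B A)) (y := #(nbrsIn Gᶜ A B))
    (by omega) (by omega) (by omega) (by omega) (by omega) (by omega)
  omega

theorem IsCritical.card_le_ten_of_card_le_one (hG : IsCritical G)
    (hcyc : ∀ n, 5 ≤ n → ¬ Nonempty (G ≃g SimpleGraph.cycleGraph n))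
    (hB : #{b | degIn Gᶜ univ b = 2} ≤ 1) : Fintype.card V ≤ 10 := by
  by_cases h : ∃ b, degIn Gᶜ univ b = 2
  · obtain ⟨b, hb⟩ := h
    exact hG.card_le_of_unique hb fun x hx => card_le_one.1 hB x (by simpa) b (by simpa)
  · exact hG.card_le_of_forall_ne hcyc (by simpa using h)

theorem IsCritical.card_le_ten (hG : IsCritical G)
    (hcyc : ∀ n, 5 ≤ n → ¬ Nonempty (G ≃g SimpleGraph.cycleGraph n))
    (hcocyc : ∀ n, 5 ≤ n → ¬ Nonempty (Gᶜ ≃g SimpleGraph.cycleGraph n)) :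
    Fintype.card V ≤ 10 := by
  by_cases hB : #{b | degIn Gᶜ univ b = 2} ≤ 1
  · exact hG.card_le_ten_of_card_le_one hcyc hB
  by_cases hA : #{a | degIn G univ a = 2} ≤ 1
  · exact hG.compl.card_le_ten_of_card_le_one hcocyc (by rwa [compl_compl])
  · exact hG.card_le_of_two_le (by omega) (by omega)

theorem prefixDegree_of_succ_eq {n : ℕ} (v : Fin n ≃ V) (i : Fin n) (hi : (i : ℕ) + 1 = n) :
    prefixDegree G v i = degIn G univ (v i) := by
  rw [prefixDegree, degIn, ← Fintype.card_subtype, ← Nat.card_eq_fintype_card]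
  refine Nat.card_congr (v.subtypeEquiv fun j => and_iff_right_of_imp fun h => ?_)
  have hne : j ≠ i := fun e => h.ne (by rw [e])
  omega

theorem exists_extreme_of_isMockThreshold [Nonempty V] (h : IsMockThreshold G) :
    ∃ v, degIn G univ v ≤ 1 ∨ Fintype.card V ≤ degIn G univ v + 2 := by
  obtain ⟨v, hv⟩ := h
  have hpos : 0 < Fintype.card V := Fintype.card_pos
  refine ⟨v ⟨Fintype.card V - 1, by omega⟩, ?_⟩
  have h := hv ⟨Fintype.card V - 1, by omega⟩
  rw [prefixDegree_of_succ_eq _ _ (by simp; omega)] at h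
  dsimp only at h
  omega

theorem isMockThreshold_of_equiv {n : ℕ} (v : Fin n ≃ V)
    (h : ∀ i : Fin n, prefixDegree G v i = 0 ∨ prefixDegree G v i = 1 ∨
      prefixDegree G v i = (i : ℕ) - 1 ∨ prefixDegree G v i = (i : ℕ)) :
    IsMockThreshold G := by
  obtain rfl : n = Fintype.card V := by simpa using Fintype.card_congr v
  exact ⟨v, h⟩

/-- An ordering of `G - x` extends to one of `G` when `x` has degree or codegree at most one. -/
theorem isMockThreshold_of_erase (x : V) [Fintype ((univ.erase x : Finset V) : Set V)]
    (h : IsMockThreshold (G.induce ((univ.erase x : Finset V) : Set V)))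
    (hx : degIn G univ x ≤ 1 ∨ Fintype.card V ≤ degIn G univ x + 2) : IsMockThreshold G := by
  have hcard : Fintype.card ((univ.erase x : Finset V) : Set V) + 1 = Fintype.card V := by
    rw [← card_univ (α := V), ← card_erase_add_one (mem_univ x)]
    simp
  unfold IsMockThreshold at h
  generalize Fintype.card ((univ.erase x : Finset V) : Set V) = n at h hcard
  obtain ⟨v, hv⟩ := h
  let f : Fin (n + 1) → V := Fin.lastCases x fun i => (v i : V)
  have hlast : f (Fin.last n) = x := Fin.lastCases_last
  have hcast : ∀ i : Fin n, f i.castSucc = v i := fun i => Fin.lastCases_castSucc i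
  have hne : ∀ i, (v i : V) ≠ x := fun i => by simpa using (v i).2
  have hinj : Function.Injective f := by
    intro i j
    cases i using Fin.lastCases <;> cases j using Fin.lastCases <;>
      simp [hlast, hcast, hne, (hne _).symm, Subtype.val_injective.eq_iff]
  let w : Fin (n + 1) ≃ V := Equiv.ofBijective f
    ((Fintype.bijective_iff_injective_and_card f).2 ⟨hinj, by simpa using hcard⟩)
  have hw : ∀ i, w i = f i := fun _ => rfl
  refine isMockThreshold_of_equiv w fun i => ?_
  cases i using Fin.lastCases with
  | last =>
    have hlt := degIn_lt_card (G := G) (mem_univ x)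
    rw [card_univ] at hlt
    rw [prefixDegree_of_succ_eq _ _ (by simp), hw, hlast, Fin.val_last]
    omega
  | cast i =>
    have : prefixDegree G w i.castSucc = prefixDegree (G.induce _) v i := by
      refine (Nat.card_eq_of_bijective
        (fun j => ⟨j.1.castSucc, by simpa [hw, hcast] using j.2⟩) ⟨?_, ?_⟩).symm
      · intro j k hjk
        simpa [Subtype.ext_iff] using hjk
      · rintro ⟨j, hj⟩
        cases j using Fin.lastCases with
        | last => exact absurd hj.1 (by simp [Fin.le_last])
        | cast j => exact ⟨⟨j, by simpa [hw, hcast] using hj⟩, rfl⟩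
    rw [this]
    exact hv i

theorem isCritical_of_isMinimalNonMockThreshold (hG : IsMinimalNonMockThreshold G) :
    IsCritical G where
  two_le v := by
    by_contra! h
    exact hG.1 (isMockThreshold_of_erase v (hG.2 _ (by simp)) (by omega))
  add_three_le v := by
    by_contra! h
    exact hG.1 (isMockThreshold_of_erase v (hG.2 _ (by simp)) (by omega))
  exists_extreme X hX hne := by
    have : Nonempty (X : Set V) := hne.to_subtype
    obtain ⟨v, hv⟩ := exists_extreme_of_isMockThreshold (hG.2 X hX)
    rw [degIn_induce] at hv
    exact ⟨v, v.2, by simpa using hv⟩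

end MockThreshold

theorem minimal_nonMockThreshold_card_le_ten {V : Type*} [Fintype V] (G : SimpleGraph V)
    (hG : IsMinimalNonMockThreshold G)
    (hcyc : ∀ n : ℕ, 5 ≤ n → ¬ Nonempty (G ≃g SimpleGraph.cycleGraph n))
    (hcocyc : ∀ n : ℕ, 5 ≤ n → ¬ Nonempty (G ≃g (SimpleGraph.cycleGraph n)ᶜ)) :
    Fintype.card V ≤ 10 := by
  refine (MockThreshold.isCritical_of_isMinimalNonMockThreshold hG).card_le_ten hcyc fun n hn ⟨φ⟩ =>
    hcocyc n hn ⟨φ.toEquiv, ?_⟩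
  intro u v
  have h := φ.map_adj_iff (v := u) (w := v)
  by_cases huv : u = v
  · simp [huv]
  · simp only [SimpleGraph.compl_adj] at h ⊢
    simp [h, huv]
end

section
/- Let G be a minimal non-mock-threshold graph on n vertices. Then every vertex of G has degree at least 2 and at most n−3. -/
/-- An ordering of a mock threshold graph may be indexed by any `Fin n`. -/
theorem IsMockThreshold.of_ordering {V : Type*} [Fintype V] {G : SimpleGraph V} {n : ℕ}
    (v : Fin n ≃ V)
    (h : ∀ i : Fin n, prefixDegree G v i = 0 ∨ prefixDegree G v i = 1 ∨
      prefixDegree G v i = (i : ℕ) - 1 ∨ prefixDegree G v i = (i : ℕ)) :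
    IsMockThreshold G := by
  obtain rfl : n = Fintype.card V := by simpa using Fintype.card_congr v
  exact ⟨v, h⟩

/-- Appending a vertex of degree `0`, `1`, `n - 2` or `n - 1` preserves mock thresholdness. -/
theorem IsMockThreshold.of_induce_compl_singleton {V : Type*} [Fintype V] {G : SimpleGraph V}
    [DecidableRel G.Adj] {x : V} {X : Finset V} (hX : ∀ y, y ∈ X ↔ y ≠ x)
    (h : IsMockThreshold (G.induce (X : Set V)))
    (hdeg : G.degree x = 0 ∨ G.degree x = 1 ∨ G.degree x = Fintype.card V - 2 ∨
      G.degree x = Fintype.card V - 1) :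
    IsMockThreshold G := by
  obtain ⟨w, hw⟩ := h
  generalize Fintype.card (X : Set V) = m at w hw
  let f : Fin (m + 1) → V := Fin.snoc (fun i => (w i : V)) x
  have hf_last : f (Fin.last m) = x := Fin.snoc_last ..
  have hf_cast (i : Fin m) : f i.castSucc = w i := Fin.snoc_castSucc ..
  have hne (i : Fin m) : (w i : V) ≠ x := (hX _).1 (w i).2
  have hf : Function.Bijective f := by
    constructor
    · exact Fin.snoc_injective_of_injective (Subtype.val_injective.comp w.injective)
        (by rintro ⟨i, hi⟩; exact hne i hi)
    · intro y
      by_cases hy : y = x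
      · exact ⟨Fin.last m, hf_last.trans hy.symm⟩
      · exact ⟨(w.symm ⟨y, (hX y).2 hy⟩).castSucc, by rw [hf_cast]; simp⟩
  let e : Fin (m + 1) ≃ V := Equiv.ofBijective f hf
  have he (i : Fin (m + 1)) : e i = f i := rfl
  have hcard : Fintype.card V = m + 1 := by simpa using (Fintype.card_congr e).symm
  refine .of_ordering e fun i => ?_
  induction i using Fin.lastCases with
  | last =>
    have hd : prefixDegree G e (Fin.last m) = G.degree x := by
      rw [← G.card_neighborSet_eq_degree, ← Nat.card_eq_fintype_card]
      refine Nat.card_congr (e.subtypeEquiv fun j => ?_)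
      rw [he (Fin.last m), hf_last, SimpleGraph.mem_neighborSet, and_iff_right_iff_imp]
      intro hadj
      refine Fin.lt_last_iff_ne_last.2 ?_
      rintro rfl
      rw [he, hf_last] at hadj
      exact hadj.ne rfl
    rw [hd, Fin.val_last]
    omega
  | cast i =>
    have hd : prefixDegree G e i.castSucc = prefixDegree (G.induce (X : Set V)) w i := by
      have hadj_iff (j : Fin m) : G.Adj (e i.castSucc) (e j.castSucc) ↔
          (G.induce (X : Set V)).Adj (w i) (w j) := by
        rw [he, he, hf_cast, hf_cast, SimpleGraph.comap_adj]
        rfl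
      refine (Nat.card_congr (Equiv.ofBijective
        (fun j => ⟨j.1.castSucc, Fin.castSucc_lt_castSucc_iff.2 j.2.1, (hadj_iff j.1).2 j.2.2⟩)
        ⟨?_, ?_⟩)).symm
      · intro j k hjk
        exact Subtype.ext (Fin.castSucc_injective _ (congrArg Subtype.val hjk))
      · rintro ⟨j, hj, hadj⟩
        induction j using Fin.lastCases with
        | last => exact absurd hj (Fin.castSucc_lt_last i).not_gt
        | cast j =>
          exact ⟨⟨j, Fin.castSucc_lt_castSucc_iff.1 hj, (hadj_iff j).1 hadj⟩, rfl⟩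
    rw [hd]
    exact hw i

theorem minimal_nonMockThreshold_degree_bounds {V : Type*} [Fintype V]
    (G : SimpleGraph V) [DecidableRel G.Adj] (hG : IsMinimalNonMockThreshold G) (v : V) :
    2 ≤ G.degree v ∧ G.degree v ≤ Fintype.card V - 3 := by
  classical
  by_contra hdeg
  have hlt := G.degree_lt_card_verts v
  refine hG.1 (.of_induce_compl_singleton (x := v) (X := Finset.univ.erase v) (by simp)
    (hG.2 _ (Finset.erase_ssubset (Finset.mem_univ v)).ne) ?_)
  omega
end

section
/- Let G be a minimal non-mock-threshold graph on n > 5 vertices that is neither a cycle of length at least 5 nor the complement of such a cycle. Then every vertex of G lies on an induced cycle of length 3 or 4. -/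
/-- Mock thresholdness may be tested with any presentation of the number of vertices. -/
theorem isMockThreshold_iff_of_card_eq {V : Type*} [Fintype V] {G : SimpleGraph V} {n : ℕ}
    (hn : Fintype.card V = n) :
    IsMockThreshold G ↔ ∃ v : Fin n ≃ V, ∀ i : Fin n,
      prefixDegree G v i = 0 ∨ prefixDegree G v i = 1 ∨
      prefixDegree G v i = (i : ℕ) - 1 ∨ prefixDegree G v i = (i : ℕ) := by
  subst hn
  rfl

/-- A nonempty graph in which every vertex has two neighbours and two non-neighbours is not
mock threshold. -/
theorem not_isMockThreshold_of_two_adj_of_two_not_adj {W : Type*} [Fintype W] [Nonempty W]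
    {H : SimpleGraph W}
    (hadj : ∀ w, ∃ x y, x ≠ y ∧ H.Adj w x ∧ H.Adj w y)
    (hnadj : ∀ w, ∃ x y, x ≠ y ∧ x ≠ w ∧ y ≠ w ∧ ¬ H.Adj w x ∧ ¬ H.Adj w y) :
    ¬ IsMockThreshold H := by
  classical
  obtain ⟨m, hm⟩ : ∃ m, Fintype.card W = m + 1 :=
    Nat.exists_eq_succ_of_ne_zero Fintype.card_ne_zero
  rw [isMockThreshold_iff_of_card_eq hm]
  rintro ⟨v, hv⟩
  have hlast := hv (Fin.last m)
  obtain ⟨x, y, hxy, hx, hy⟩ := hadj (v (Fin.last m))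
  obtain ⟨z, t, hzt, hz, ht, hz', ht'⟩ := hnadj (v (Fin.last m))
  have hlt : ∀ u, u ≠ v (Fin.last m) → v.symm u < Fin.last m := fun u hu =>
    Fin.lt_last_iff_ne_last.2 fun h => hu (by rw [← h, v.apply_symm_apply])
  have hdeg : prefixDegree H v (Fin.last m) =
      ((Finset.Iio (Fin.last m)).filter fun j => H.Adj (v (Fin.last m)) (v j)).card := by
    rw [prefixDegree, Nat.card_eq_fintype_card, Fintype.card_subtype]
    congr 1
    ext j
    rw [Finset.mem_filter_univ, Finset.mem_filter, Finset.mem_Iio]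
  have hsum := Finset.card_filter_add_card_filter_not (s := Finset.Iio (Fin.last m))
    (fun j => H.Adj (v (Fin.last m)) (v j))
  have htwo : 1 < ((Finset.Iio (Fin.last m)).filter
      fun j => H.Adj (v (Fin.last m)) (v j)).card :=
    Finset.one_lt_card.2 ⟨
      v.symm x, Finset.mem_filter.2 ⟨Finset.mem_Iio.2 (hlt x hx.ne'), by simpa using hx⟩,
      v.symm y, Finset.mem_filter.2 ⟨Finset.mem_Iio.2 (hlt y hy.ne'), by simpa using hy⟩,
      fun h => hxy (v.symm.injective h)⟩
  have htwo' : 1 < ((Finset.Iio (Fin.last m)).filter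
      fun j => ¬ H.Adj (v (Fin.last m)) (v j)).card :=
    Finset.one_lt_card.2 ⟨
      v.symm z, Finset.mem_filter.2 ⟨Finset.mem_Iio.2 (hlt z hz), by simpa using hz'⟩,
      v.symm t, Finset.mem_filter.2 ⟨Finset.mem_Iio.2 (hlt t ht), by simpa using ht'⟩,
      fun h => hzt (v.symm.injective h)⟩
  rw [Fin.card_Iio] at hsum
  simp only [Fin.val_last] at hsum hlast
  omega

/-- Adding a vertex of degree at most one preserves mock thresholdness. -/
theorem isMockThreshold_of_induce_ne {V : Type*} [Fintype V] {G : SimpleGraph V} {x : V}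
    {s : Set V} [Fintype s] (hs : ∀ y, y ∈ s ↔ y ≠ x)
    (hx : ∀ y z, G.Adj x y → G.Adj x z → y = z) (h : IsMockThreshold (G.induce s)) :
    IsMockThreshold G := by
  classical
  obtain ⟨e, he⟩ := h
  generalize Fintype.card s = m at e he
  let σ : Fin (m + 1) ≃ V := finSuccEquivLast.trans ((e.optionCongr).trans
    ((Equiv.subtypeEquivRight hs).optionCongr.trans (Equiv.optionSubtypeNe x)))
  have hσ : ∀ i : Fin m, σ i.castSucc = e i := fun i => by
    simp [σ]
  have hσ' : σ (Fin.last m) = x := by simp [σ]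
  have hcard : Fintype.card V = m + 1 := by
    simpa using (Fintype.card_congr σ).symm
  rw [isMockThreshold_iff_of_card_eq hcard]
  refine ⟨σ, fun i => ?_⟩
  induction i using Fin.lastCases with
  | last =>
    have hle : prefixDegree G σ (Fin.last m) ≤ 1 := by
      rw [prefixDegree]
      refine Finite.card_le_one_iff_subsingleton.2 ⟨fun j k => Subtype.ext (σ.injective ?_)⟩
      exact hx _ _ (hσ' ▸ j.2.2) (hσ' ▸ k.2.2)
    omega
  | cast i =>
    have heq : prefixDegree G σ i.castSucc = prefixDegree (G.induce s) e i := by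
      refine (Nat.card_congr (Equiv.ofBijective
        (fun j => ⟨j.1.castSucc, Fin.castSucc_lt_castSucc_iff.2 j.2.1,
          by simpa [hσ] using j.2.2⟩) ⟨?_, ?_⟩)).symm
      · intro j k hjk
        simpa [Subtype.ext_iff] using hjk
      · rintro ⟨j, hj, hadj⟩
        obtain ⟨j, rfl⟩ := Fin.eq_castSucc_of_ne_last (hj.trans_le (Fin.le_last _)).ne
        rw [hσ, hσ] at hadj
        exact ⟨⟨j, Fin.castSucc_lt_castSucc_iff.1 hj, hadj⟩, rfl⟩
    rw [heq]
    exact he i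

/-- Adjacency in a cycle, for indices in increasing order. -/
theorem cycleGraph_adj_of_lt {L : ℕ} {i j : Fin (L + 2)} (hij : i < j) :
    (SimpleGraph.cycleGraph (L + 2)).Adj i j ↔
      (j : ℕ) = i + 1 ∨ ((i : ℕ) = 0 ∧ (j : ℕ) = L + 1) := by
  have hij' : (i : ℕ) < j := hij
  have hj := j.2
  rw [SimpleGraph.cycleGraph_adj', Fin.sub_val_of_le hij.le, Fin.val_sub]
  rw [Nat.mod_eq_of_lt (by omega)]
  omega

/-- A cycle of length at least five is not mock threshold. -/
theorem not_isMockThreshold_of_iso_cycleGraph {W : Type*} [Fintype W] {H : SimpleGraph W}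
    {k : ℕ} (hk : 5 ≤ k) (e : H ≃g SimpleGraph.cycleGraph k) : ¬ IsMockThreshold H := by
  obtain ⟨n, rfl⟩ : ∃ n, k = n + 3 + 2 := ⟨k - 5, by omega⟩
  have : Nonempty W := ⟨e.symm 0⟩
  have hadj : ∀ w (c : Fin (n + 3 + 2)), H.Adj w (e.symm (e w + c)) ↔ c = -1 ∨ c = 1 := by
    intro w c
    rw [← e.map_adj_iff, e.apply_symm_apply, SimpleGraph.cycleGraph_adj]
    simp [neg_eq_iff_eq_neg]
  have hne : ∀ w (c d : Fin (n + 3 + 2)), c ≠ d → e.symm (e w + c) ≠ e.symm (e w + d) :=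
    fun w c d hcd h => hcd (add_left_cancel (e.symm.injective h))
  have hne' : ∀ w (c : Fin (n + 3 + 2)), c ≠ 0 → e.symm (e w + c) ≠ w := fun w c hc h =>
    hne w c 0 hc (by simpa using h)
  have h1 : ((1 : Fin (n + 3 + 2)) : ℕ) = 1 := rfl
  have h2 : ((2 : Fin (n + 3 + 2)) : ℕ) = 2 := rfl
  have h1' : ((-1 : Fin (n + 3 + 2)) : ℕ) = n + 4 := by
    rw [Fin.val_neg']; simp
  have h2' : ((-2 : Fin (n + 3 + 2)) : ℕ) = n + 3 := by
    rw [Fin.val_neg', h2, Nat.mod_eq_of_lt] <;> omega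
  refine not_isMockThreshold_of_two_adj_of_two_not_adj (fun w => ?_) fun w => ?_
  · refine ⟨e.symm (e w + 1), e.symm (e w + -1), hne _ _ _ ?_, ?_, ?_⟩
    · simp only [ne_eq, Fin.ext_iff, h1, h1']; omega
    · simp [hadj]
    · simp [hadj]
  · refine ⟨e.symm (e w + 2), e.symm (e w + -2), hne _ _ _ ?_, hne' _ _ ?_, hne' _ _ ?_, ?_, ?_⟩
    all_goals
      simp only [hadj, ne_eq, Fin.ext_iff, h1, h2, h1', h2', Fin.val_zero]; omega

/-- If all vertices of a nonempty finite set have two neighbours inside it, except for at most one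
vertex which has at least one, then some nonempty subset has minimum degree at least two. -/
theorem exists_subset_two_adj {V : Type*} (G : SimpleGraph V) (A : Finset V) (a : V) (ha : a ∈ A)
    (hone : ∃ y ∈ A, G.Adj a y)
    (htwo : ∀ x ∈ A, x ≠ a → ∃ y ∈ A, ∃ z ∈ A, y ≠ z ∧ G.Adj x y ∧ G.Adj x z) :
    ∃ S ⊆ A, S.Nonempty ∧ ∀ x ∈ S, ∃ y ∈ S, ∃ z ∈ S, y ≠ z ∧ G.Adj x y ∧ G.Adj x z := by
  classical
  induction A using Finset.strongInduction generalizing a with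
  | H A ih =>
  obtain ⟨b, hb, hab⟩ := hone
  by_cases h : ∃ y ∈ A, y ≠ b ∧ G.Adj a y
  · obtain ⟨y, hy, hyb, hay⟩ := h
    refine ⟨A, subset_rfl, ⟨a, ha⟩, fun x hx => ?_⟩
    by_cases hxa : x = a
    · subst hxa
      exact ⟨y, hy, b, hb, hyb, hay, hab⟩
    · exact htwo x hx hxa
  · push Not at h
    have hone' : ∃ y ∈ A.erase a, G.Adj b y := by
      obtain ⟨y, hy, z, hz, hyz, hby, hbz⟩ := htwo b hb hab.ne'
      by_cases hya : y = a
      · exact ⟨z, Finset.mem_erase.2 ⟨fun h => hyz (hya.trans h.symm), hz⟩, hbz⟩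
      · exact ⟨y, Finset.mem_erase.2 ⟨hya, hy⟩, hby⟩
    obtain ⟨S, hS, hS'⟩ := ih (A.erase a) (Finset.erase_ssubset ha) b
      (Finset.mem_erase.2 ⟨hab.ne', hb⟩) hone' fun x hx hxb => by
        obtain ⟨hxa, hxA⟩ := Finset.mem_erase.1 hx
        obtain ⟨y, hy, z, hz, hyz, hxy, hxz⟩ := htwo x hxA hxa
        have hne : ∀ y, G.Adj x y → y ≠ a := by
          rintro y hy rfl
          exact h x hxA hxb hy.symm
        exact ⟨y, Finset.mem_erase.2 ⟨hne y hxy, hy⟩, z, Finset.mem_erase.2 ⟨hne z hxz, hz⟩,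
          hyz, hxy, hxz⟩
    exact ⟨S, hS.trans (Finset.erase_subset _ _), hS'⟩

/-- If two neighbours of `v` are connected in the graph with `v` isolated, then `v` lies on an
induced cycle. -/
theorem exists_cycleGraph_embedding {V : Type*} (G : SimpleGraph V) (v : V) {H : SimpleGraph V}
    (hH : ∀ x y, H.Adj x y ↔ G.Adj x y ∧ x ≠ v ∧ y ≠ v) {a b : V} (hab : a ≠ b)
    (ha : G.Adj v a) (hb : G.Adj v b) (hreach : H.Reachable a b) :
    ∃ (L : ℕ) (f : SimpleGraph.cycleGraph (L + 2) ↪g G), 1 ≤ L ∧ f 0 = v := by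
  classical
  have hex : ∃ L, ∃ a b, a ≠ b ∧ G.Adj v a ∧ G.Adj v b ∧ ∃ p : H.Walk a b, p.length = L :=
    hreach.elim fun p => ⟨_, a, b, hab, ha, hb, p, rfl⟩
  obtain ⟨a, b, hab, ha, hb, p, hp⟩ := Nat.find_spec hex
  have hmin : ∀ a b, a ≠ b → G.Adj v a → G.Adj v b → ∀ q : H.Walk a b, p.length ≤ q.length :=
    fun a b h h1 h2 q => hp ▸ Nat.find_min' hex ⟨a, b, h, h1, h2, q, rfl⟩
  clear hp
  have hpos : 1 ≤ p.length := Nat.one_le_iff_ne_zero.2 fun h =>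
    hab (SimpleGraph.Walk.eq_of_length_eq_zero h)
  have hinj : ∀ i j, i < j → j ≤ p.length → p.getVert i ≠ p.getVert j := by
    intro i j hij hj h
    have := hmin a b hab ha hb ((p.take i).append ((p.drop j).copy h.symm rfl))
    simp only [SimpleGraph.Walk.length_append, SimpleGraph.Walk.length_copy,
      SimpleGraph.Walk.take_length, SimpleGraph.Walk.drop_length] at this
    omega
  have hchord : ∀ i j, i < j → j ≤ p.length → H.Adj (p.getVert i) (p.getVert j) → j = i + 1 := by
    intro i j hij hj h
    have := hmin a b hab ha hb ((p.take i).append (.cons h (p.drop j)))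
    simp only [SimpleGraph.Walk.length_append, SimpleGraph.Walk.length_cons,
      SimpleGraph.Walk.take_length, SimpleGraph.Walk.drop_length] at this
    omega
  have hv : ∀ i ≤ p.length, p.getVert i ≠ v := by
    intro i hi h
    rcases hi.lt_or_eq with hi | rfl
    · exact ((hH _ _).1 (p.adj_getVert_succ hi)).2.1 h
    · exact hb.ne' (by simpa using h)
  have hvadj : ∀ i ≤ p.length, G.Adj v (p.getVert i) → i = 0 ∨ i = p.length := by
    intro i hi h
    by_contra! hc
    have hai : a ≠ p.getVert i := by
      simpa using hinj 0 i (by omega) hi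
    have := hmin a _ hai ha h (p.take i)
    simp only [SimpleGraph.Walk.take_length] at this
    omega
  let f : Fin (p.length + 2) → V := Fin.cons v fun i : Fin (p.length + 1) => p.getVert i
  have hkey : ∀ i j : Fin (p.length + 2), i < j → f i ≠ f j ∧
      (G.Adj (f i) (f j) ↔ (SimpleGraph.cycleGraph (p.length + 2)).Adj i j) := by
    intro i j hij
    rw [cycleGraph_adj_of_lt hij]
    induction j using Fin.cases with
    | zero => exact absurd hij (Fin.not_lt_zero _)
    | succ j =>
    have hj : (j : ℕ) ≤ p.length := Nat.lt_succ_iff.1 j.2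
    induction i using Fin.cases with
    | zero =>
      refine ⟨(hv j hj).symm, fun h => ?_, fun h => ?_⟩
      · simpa using hvadj j hj h
      · have h' : (j : ℕ) = 0 ∨ (j : ℕ) = p.length := by simpa using h
        change G.Adj v (p.getVert j)
        rcases h' with h' | h' <;> simpa [h']
    | succ i =>
      have hij' : (i : ℕ) < j := Fin.succ_lt_succ_iff.1 hij
      refine ⟨hinj i j hij' hj, fun h => ?_, fun h => ?_⟩
      · have := hchord i j hij' hj ((hH _ _).2 ⟨h, hv i (by omega), hv j hj⟩)
        simp [this]
      · have h' : (j : ℕ) = i + 1 := by simpa using h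
        change G.Adj (p.getVert i) (p.getVert j)
        rw [h']
        exact ((hH _ _).1 (p.adj_getVert_succ (by omega))).1
  refine ⟨p.length, ⟨⟨f, fun i j h => ?_⟩, fun {i j} => ?_⟩, hpos, rfl⟩
  · rcases lt_trichotomy i j with hij | hij | hij
    · exact absurd h (hkey i j hij).1
    · exact hij
    · exact absurd h.symm (hkey j i hij).1
  · change G.Adj (f i) (f j) ↔ _
    rcases lt_trichotomy i j with hij | rfl | hij
    · exact (hkey i j hij).2
    · simp
    · rw [G.adj_comm, (hkey j i hij).2, SimpleGraph.adj_comm]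

/-- If `a` is the only neighbour of `v` in its component of the graph with `v` isolated, and all
degrees are at least two, then that component contains a set of minimum degree at least two. -/
theorem exists_two_adj_in_component {V : Type*} [Fintype V] (G : SimpleGraph V) {v a : V}
    {H : SimpleGraph V} (hH : ∀ x y, H.Adj x y ↔ G.Adj x y ∧ x ≠ v ∧ y ≠ v)
    (hdeg : ∀ x, ∃ y z, y ≠ z ∧ G.Adj x y ∧ G.Adj x z) (ha : G.Adj v a)
    (hcomp : ∀ b, b ≠ a → G.Adj v b → ¬ H.Reachable a b) :
    ∃ S : Finset V, S.Nonempty ∧ (∀ x ∈ S, H.Reachable a x) ∧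
      ∀ x ∈ S, ∃ y ∈ S, ∃ z ∈ S, y ≠ z ∧ G.Adj x y ∧ G.Adj x z := by
  classical
  have hv : ∀ x, H.Reachable a x → x ≠ v := by
    rintro x hx rfl
    obtain ⟨y, hy⟩ := hx.symm.exists_isPath
    cases y with
    | nil => exact ha.ne rfl
    | cons h _ => exact ((hH _ _).1 h).2.1 rfl
  have hstep : ∀ x y, H.Reachable a x → G.Adj x y → y ≠ v → H.Reachable a y :=
    fun x y hx hxy hy => hx.trans ((hH _ _).2 ⟨hxy, hv x hx, hy⟩).reachable
  have hone : ∃ y ∈ Finset.univ.filter fun x => H.Reachable a x, G.Adj a y := by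
    obtain ⟨y, z, hyz, hy, hz⟩ := hdeg a
    by_cases hyv : y = v
    · exact ⟨z, by simpa using hstep a z .rfl hz fun h => hyz (hyv.trans h.symm), hz⟩
    · exact ⟨y, by simpa using hstep a y .rfl hy hyv, hy⟩
  obtain ⟨S, hS, hne, hS'⟩ := exists_subset_two_adj G
    (Finset.univ.filter fun x => H.Reachable a x) a (by simp) hone fun x hx hxa => by
      have hx : H.Reachable a x := by simpa using hx
      have hxv : ∀ y, G.Adj x y → y ≠ v := by
        rintro y hy rfl
        exact hcomp x hxa hy.symm hx
      obtain ⟨y, z, hyz, hy, hz⟩ := hdeg x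
      exact ⟨y, by simpa using hstep x y hx hy (hxv y hy), z,
        by simpa using hstep x z hx hz (hxv z hz), hyz, hy, hz⟩
  exact ⟨S, hne, fun x hx => by simpa using hS hx, hS'⟩

theorem minimal_nonMockThreshold_vertex_on_short_cycle {V : Type*} [Fintype V]
    (G : SimpleGraph V) (hG : IsMinimalNonMockThreshold G)
    (hcard : 5 < Fintype.card V)
    (hcyc : ∀ n : ℕ, 5 ≤ n → ¬ Nonempty (G ≃g SimpleGraph.cycleGraph n))
    (hcocyc : ∀ n : ℕ, 5 ≤ n → ¬ Nonempty (G ≃g (SimpleGraph.cycleGraph n)ᶜ))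
    (v : V) :
    ∃ (k : ℕ) (X : Finset V), (k = 3 ∨ k = 4) ∧ v ∈ X ∧
      Nonempty ((G.induce (X : Set V)) ≃g SimpleGraph.cycleGraph k) := by
  classical
  by_contra hcon
  have hdeg : ∀ x, ∃ y z, y ≠ z ∧ G.Adj x y ∧ G.Adj x z := by
    intro x
    by_contra! hx
    exact hG.1 (isMockThreshold_of_induce_ne (x := x) (s := (Finset.univ.erase x : Finset V))
      (by simp) (fun y z hy hz => by_contra fun h => hx y z h hy hz)
      (hG.2 _ (Finset.erase_ssubset (Finset.mem_univ x)).ne))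
  let H : SimpleGraph V := SimpleGraph.mk (fun x y => G.Adj x y ∧ x ≠ v ∧ y ≠ v)
    ⟨fun x y h => ⟨h.1.symm, h.2.2, h.2.1⟩⟩ ⟨fun x h => h.1.ne rfl⟩
  have hH : ∀ x y, H.Adj x y ↔ G.Adj x y ∧ x ≠ v ∧ y ≠ v := fun _ _ => Iff.rfl
  have hsep : ∀ a b, a ≠ b → G.Adj v a → G.Adj v b → ¬ H.Reachable a b := by
    intro a b hab ha hb hreach
    obtain ⟨L, f, hL, hf⟩ := exists_cycleGraph_embedding G v hH hab ha hb hreach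
    obtain ⟨X, hX⟩ : ∃ X : Finset V, (X : Set V) = Set.range f :=
      ⟨(Set.range f).toFinset, by simp⟩
    have e : G.induce (X : Set V) ≃g SimpleGraph.cycleGraph (L + 2) := by
      rw [hX]
      exact f.isoInduceRange.symm
    by_cases hL' : L + 2 < 5
    · exact hcon ⟨L + 2, X, by omega, by rw [← Finset.mem_coe, hX]; exact ⟨0, hf⟩, ⟨e⟩⟩
    · by_cases hXu : X = Finset.univ
      · subst hXu
        rw [Finset.coe_univ] at e
        exact hcyc (L + 2) (by omega) ⟨(SimpleGraph.induceUnivIso G).symm.trans e⟩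
      · exact not_isMockThreshold_of_iso_cycleGraph (by omega) e (hG.2 X hXu)
  obtain ⟨a, b, hab, ha, hb⟩ := hdeg v
  obtain ⟨S, hSne, hS, hS'⟩ := exists_two_adj_in_component G hH hdeg ha
    fun c hc hc' => hsep a c hc.symm ha hc'
  obtain ⟨T, hTne, hT, hT'⟩ := exists_two_adj_in_component G hH hdeg hb
    fun c hc hc' => hsep b c hc.symm hb hc'
  have hv : ∀ c, G.Adj v c → ¬ H.Reachable v c := by
    rintro c hc ⟨p⟩
    cases p with
    | nil => exact hc.ne rfl
    | cons h _ => exact ((hH _ _).1 h).2.1 rfl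
  have hvS : v ∉ S := fun h => hv a ha (hS v h).symm
  have hvT : v ∉ T := fun h => hv b hb (hT v h).symm
  have hdisj : ∀ x ∈ S, ∀ y ∈ T, x ≠ y ∧ ¬ G.Adj x y := by
    refine fun x hx y hy => ⟨?_, fun h => ?_⟩
    · rintro rfl
      exact hsep a b hab ha hb ((hS x hx).trans (hT x hy).symm)
    · have hxy : H.Adj x y := ⟨h, fun h => hvS (h ▸ hx), fun h => hvT (h ▸ hy)⟩
      exact hsep a b hab ha hb ((hS x hx).trans (hxy.reachable.trans (hT y hy).symm))
  have hproper : S ∪ T ≠ Finset.univ := fun h => by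
    have := h ▸ Finset.mem_univ v
    simp [hvS, hvT] at this
  have hne : Nonempty ((S ∪ T : Finset V) : Set V) :=
    hSne.elim fun x hx => ⟨⟨x, by simp [hx]⟩⟩
  refine not_isMockThreshold_of_two_adj_of_two_not_adj ?_ ?_ (hG.2 (S ∪ T) hproper)
  · rintro ⟨x, hx⟩
    rcases Finset.mem_union.1 (Finset.mem_coe.1 hx) with hx | hx
    · obtain ⟨y, hy, z, hz, hyz, hxy, hxz⟩ := hS' x hx
      exact ⟨⟨y, by simp [hy]⟩, ⟨z, by simp [hz]⟩, by simpa using hyz, hxy, hxz⟩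
    · obtain ⟨y, hy, z, hz, hyz, hxy, hxz⟩ := hT' x hx
      exact ⟨⟨y, by simp [hy]⟩, ⟨z, by simp [hz]⟩, by simpa using hyz, hxy, hxz⟩
  · rintro ⟨x, hx⟩
    rcases Finset.mem_union.1 (Finset.mem_coe.1 hx) with hx | hx
    · obtain ⟨t, ht⟩ := hTne
      obtain ⟨y, hy, z, hz, hyz, -⟩ := hT' t ht
      exact ⟨⟨y, by simp [hy]⟩, ⟨z, by simp [hz]⟩, by simpa using hyz,
        by simpa using (hdisj x hx y hy).1.symm, by simpa using (hdisj x hx z hz).1.symm,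
        (hdisj x hx y hy).2, (hdisj x hx z hz).2⟩
    · obtain ⟨t, ht⟩ := hSne
      obtain ⟨y, hy, z, hz, hyz, -⟩ := hS' t ht
      exact ⟨⟨y, by simp [hy]⟩, ⟨z, by simp [hz]⟩, by simpa using hyz,
        by simpa using (hdisj y hy x hx).1, by simpa using (hdisj z hz x hx).1,
        fun h => (hdisj y hy x hx).2 h.symm, fun h => (hdisj z hz x hx).2 h.symm⟩
end
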